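/- Let d ≥ 1 and α > 0. For every probability measure μ on ℝᵈ with finite first moment, the functional F_μ(ρ) := E(ρ) + T(ρ,μ) + (α/2)M₂(ρ) admits a unique minimizer ρ over the probability measures on ℝᵈ with finite first moment. Moreover there exist a convex lower-semicontinuous function u : ℝᵈ → ℝ ∪ {+∞} and a constant Z > 0 such that ρ is absolutely continuous with density x ↦ (1/Z)·exp(−u(x) − (α/2)‖x‖²) and T(ρ,μ) = ∫ u dρ + ∫ u* dμ, where u* is the Legendre transform of u. -/

import Mathlib

open MeasureTheory ENNReal
open scoped RealInnerProductSpace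

noncomputable section

/-- Euclidean space `ℝᵈ`. -/
abbrev Ed (d : ℕ) := EuclideanSpace ℝ (Fin d)

/-- The positive part of an extended real number, as an element of `ℝ≥0∞`. -/
noncomputable def EReal.posPart (a : EReal) : ℝ≥0∞ :=
  if a = ⊤ then ⊤ else ENNReal.ofReal a.toReal

/-- Signed integral (with values in `EReal`) of a real-valued function. -/
noncomputable def sInt {α : Type*} [MeasurableSpace α] (ν : Measure α) (g : α → ℝ) : EReal :=
  ((∫⁻ x, ENNReal.ofReal (g x) ∂ν : ℝ≥0∞) : EReal) -
    ((∫⁻ x, ENNReal.ofReal (-(g x)) ∂ν : ℝ≥0∞) : EReal)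

/-- Signed integral (with values in `EReal`) of an `EReal`-valued function. -/
noncomputable def eInt {α : Type*} [MeasurableSpace α] (ν : Measure α) (f : α → EReal) : EReal :=
  ((∫⁻ x, (f x).posPart ∂ν : ℝ≥0∞) : EReal) - ((∫⁻ x, (-(f x)).posPart ∂ν : ℝ≥0∞) : EReal)

/-- The set of couplings (transport plans) between two measures on `ℝᵈ`. -/
def couplings {d : ℕ} (ρ μ : Measure (Ed d)) : Set (Measure (Ed d × Ed d)) :=
  {γ | IsProbabilityMeasure γ ∧ γ.map Prod.fst = ρ ∧ γ.map Prod.snd = μ}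

/-- The maximal correlation functional `T(ρ, μ)`. -/
noncomputable def maxCorr {d : ℕ} (ρ μ : Measure (Ed d)) : EReal :=
  ⨆ γ ∈ couplings ρ μ, sInt γ (fun p => ⟪p.1, p.2⟫)

/-- The entropy `E(ρ)` of a measure with respect to Lebesgue measure. -/
noncomputable def Ent {d : ℕ} (ρ : Measure (Ed d)) : EReal := by
  classical
  exact if _h : ρ ≪ (volume : Measure (Ed d)) then
    sInt (volume : Measure (Ed d))
      (fun x => (ρ.rnDeriv volume x).toReal * Real.log (ρ.rnDeriv volume x).toReal)
  else ⊤

/-- The second moment of a measure, with values in `ℝ≥0∞`. -/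
noncomputable def M2e {d : ℕ} (ρ : Measure (Ed d)) : ℝ≥0∞ :=
  ∫⁻ x, ENNReal.ofReal (‖x‖ ^ 2) ∂ρ

/-- The regularized functional `F_μ(ρ) = E(ρ) + T(ρ, μ) + (α/2) M₂(ρ)`. -/
noncomputable def Ffun {d : ℕ} (α : ℝ) (μ ρ : Measure (Ed d)) : EReal :=
  Ent ρ + maxCorr ρ μ + ((α / 2 : ℝ) : EReal) * ((M2e ρ : ℝ≥0∞) : EReal)

/-- The `p`-th moment `M_p(ρ) = ∫ ‖x‖^p dρ`. -/
noncomputable def Mp {d : ℕ} (p : ℝ) (ρ : Measure (Ed d)) : ℝ :=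
  ∫ x, ‖x‖ ^ p ∂ρ

/-- The barycenter `b(ρ) = ∫ x dρ`. -/
noncomputable def bary {d : ℕ} (ρ : Measure (Ed d)) : Ed d :=
  ∫ x, x ∂ρ

/-- Probability measures on `ℝᵈ` with finite first moment. -/
def P1 (d : ℕ) : Set (Measure (Ed d)) :=
  {ρ | IsProbabilityMeasure ρ ∧ Integrable (fun x => ‖x‖) ρ}

/-- Probability measures on `ℝᵈ` with finite second moment. -/
def P2 (d : ℕ) : Set (Measure (Ed d)) :=
  {ρ | IsProbabilityMeasure ρ ∧ Integrable (fun x => ‖x‖ ^ 2) ρ}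

/-- `ρ` is a minimizer of `F_μ` over probability measures with finite first moment. -/
def IsMinOfF {d : ℕ} (α : ℝ) (μ ρ : Measure (Ed d)) : Prop :=
  ρ ∈ P1 d ∧ ∀ σ ∈ P1 d, Ffun α μ ρ ≤ Ffun α μ σ

/-- The 2-Wasserstein distance between two measures on `ℝᵈ`. -/
noncomputable def W2 {d : ℕ} (ρ μ : Measure (Ed d)) : ℝ :=
  Real.sqrt ((⨅ γ ∈ couplings ρ μ, ∫⁻ p, ENNReal.ofReal (‖p.1 - p.2‖ ^ 2) ∂γ).toReal)

/-- Convexity of an `EReal`-valued function on `ℝᵈ`. -/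
def EConvexOn {d : ℕ} (u : Ed d → EReal) : Prop :=
  ∀ x y : Ed d, ∀ s t : ℝ, 0 ≤ s → 0 ≤ t → s + t = 1 →
    u (s • x + t • y) ≤ (s : EReal) * u x + (t : EReal) * u y

/-- The Legendre transform `u*(y) = sup_x (⟨x, y⟩ - u(x))` of an `EReal`-valued function. -/
noncomputable def legendre {d : ℕ} (u : Ed d → EReal) : Ed d → EReal :=
  fun y => ⨆ x : Ed d, (((⟪x, y⟫ : ℝ) : EReal) - u x)

/-- The Gaussian-regularized density `exp(-u(x) - (α/2)‖x‖²)`, with value `0` where `u = ⊤`. -/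
noncomputable def gdens {d : ℕ} (α : ℝ) (u : Ed d → EReal) (x : Ed d) : ℝ≥0∞ :=
  if u x = ⊤ then 0 else ENNReal.ofReal (Real.exp (-(u x).toReal - (α / 2) * ‖x‖ ^ 2))

section PrekopaLeindler
open Set

/-- The midpoint form of the Prékopa–Leindler inequality on a measure space. -/
def PrekopaLeindler (E : Type*) [AddCommGroup E] [Module ℝ E] [MeasureSpace E] : Prop :=
  ∀ f g h : E → ℝ≥0∞, Measurable f → Measurable g → Measurable h →
    (∀ x y, f x * g y ≤ h ((2⁻¹ : ℝ) • (x + y)) ^ 2) →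
    (∫⁻ x, f x) * (∫⁻ x, g x) ≤ (∫⁻ x, h x) ^ 2

theorem volume_le_two_mul_of_maps {A C : Set ℝ} (b : ℝ)
    (h : ∀ x ∈ A, 2⁻¹ * (x + b) ∈ C) : volume A ≤ 2 * volume C := by
  have h1 : A ⊆ (fun x => 2⁻¹ * x) ⁻¹' ((fun x => x + 2⁻¹ * b) ⁻¹' C) := by
    intro x hx
    have := h x hx
    simp only [mem_preimage]
    rwa [mul_add] at this
  refine (measure_mono h1).trans ?_
  rw [Real.volume_preimage_mul_left (by norm_num), measure_preimage_add_right]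
  apply le_of_eq
  norm_num

theorem brunn_minkowski_real {A B C : Set ℝ} (hA : MeasurableSet A) (hB : MeasurableSet B)
    (hA' : A.Nonempty) (hB' : B.Nonempty)
    (h : ∀ x ∈ A, ∀ y ∈ B, 2⁻¹ * (x + y) ∈ C) :
    volume A + volume B ≤ 2 * volume C := by
  obtain ⟨a₀, ha₀⟩ := hA'
  obtain ⟨b₀, hb₀⟩ := hB'
  have key : ∀ K ⊆ A, IsCompact K → ∀ L ⊆ B, IsCompact L → volume K + volume L ≤ 2 * volume C := by
    intro K hKA hK L hLB hL
    rcases K.eq_empty_or_nonempty with rfl | hKn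
    · rw [measure_empty, zero_add]
      refine volume_le_two_mul_of_maps a₀ fun y hy => ?_
      rw [add_comm]
      exact h _ ha₀ _ (hLB hy)
    rcases L.eq_empty_or_nonempty with rfl | hLn
    · rw [measure_empty, add_zero]
      exact volume_le_two_mul_of_maps b₀ fun x hx => h _ (hKA hx) _ hb₀
    obtain ⟨a, ha, ha'⟩ := hK.exists_isGreatest hKn
    obtain ⟨b, hb, hb'⟩ := hL.exists_isLeast hLn
    have h1 : volume K ≤ 2 * volume (C ∩ Iic (2⁻¹ * (a + b))) := by
      refine volume_le_two_mul_of_maps b fun x hx => ⟨h _ (hKA hx) _ (hLB hb), ?_⟩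
      have := ha' hx
      simp only [mem_Iic]
      linarith
    have h2 : volume L ≤ 2 * volume (C ∩ Ici (2⁻¹ * (a + b))) := by
      refine volume_le_two_mul_of_maps a fun x hx => ⟨?_, ?_⟩
      · rw [add_comm]; exact h _ (hKA ha) _ (hLB hx)
      · have := hb' hx
        simp only [mem_Ici]
        linarith
    have h3 : volume (C ∩ Ici (2⁻¹ * (a + b))) = volume (C ∩ Ioi (2⁻¹ * (a + b))) := by
      apply measure_congr
      exact (Filter.EventuallyEq.refl _ C).inter Ioi_ae_eq_Ici.symm
    have h4 : volume (C ∩ Iic (2⁻¹ * (a + b))) + volume (C ∩ Ioi (2⁻¹ * (a + b))) = volume C := by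
      rw [← measure_inter_add_sdiff C (measurableSet_Iic (a := 2⁻¹ * (a + b)))]
      congr 2
      ext x; simp
    calc volume K + volume L ≤ _ := add_le_add h1 h2
      _ = 2 * volume C := by rw [h3, ← mul_add, h4]
  rw [hA.measure_eq_iSup_isCompact, hB.measure_eq_iSup_isCompact]
  simp only [iSup_and']
  refine ENNReal.biSup_add_biSup_le' ⟨∅, empty_subset _, isCompact_empty⟩
    ⟨∅, empty_subset _, isCompact_empty⟩ ?_
  rintro K ⟨hK, hK'⟩ L ⟨hL, hL'⟩
  exact key K hK hK' L hL hL'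

theorem lintegral_eq_lintegral_meas_ofReal_lt {f : ℝ → ℝ≥0∞} (hf : Measurable f)
    (hfin : ∀ x, f x ≠ ∞) :
    ∫⁻ x, f x = ∫⁻ t in Ioi (0 : ℝ), volume {x | ENNReal.ofReal t < f x} := by
  have h1 := lintegral_eq_lintegral_meas_lt (volume : Measure ℝ) (f := fun x => (f x).toReal)
    (Filter.Eventually.of_forall fun x => ENNReal.toReal_nonneg) hf.ennreal_toReal.aemeasurable
  simp only [ENNReal.ofReal_toReal (hfin _)] at h1
  rw [h1]
  refine setLIntegral_congr_fun measurableSet_Ioi fun t ht => ?_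
  simp only [ENNReal.ofReal_lt_iff_lt_toReal (le_of_lt ht) (hfin _)]

theorem prekopaLeindler_real_of_iSup_eq_one {f g h : ℝ → ℝ≥0∞} (hf : Measurable f)
    (hg : Measurable g) (hh : Measurable h)
    (hf1 : ⨆ x, f x = 1) (hg1 : ⨆ x, g x = 1)
    (H : ∀ x y, f x * g y ≤ h (2⁻¹ * (x + y)) ^ 2) :
    (∫⁻ x, f x) + (∫⁻ x, g x) ≤ 2 * ∫⁻ x, h x := by
  have hfle : ∀ x, f x ≤ 1 := fun x => hf1 ▸ le_iSup f x
  have hgle : ∀ x, g x ≤ 1 := fun x => hg1 ▸ le_iSup g x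
  have hmin : ∫⁻ x, min (h x) 1 ≤ ∫⁻ x, h x := lintegral_mono fun x => min_le_left _ _
  refine le_trans ?_ (mul_le_mul_right hmin 2)
  rw [lintegral_eq_lintegral_meas_ofReal_lt hf fun x => ne_top_of_le_ne_top one_ne_top (hfle x),
    lintegral_eq_lintegral_meas_ofReal_lt hg fun x => ne_top_of_le_ne_top one_ne_top (hgle x),
    lintegral_eq_lintegral_meas_ofReal_lt (hh.min measurable_const)
      fun x => ne_top_of_le_ne_top one_ne_top (min_le_right _ _)]
  have hm : ∀ k : ℝ → ℝ≥0∞, Measurable fun t : ℝ => volume {x | ENNReal.ofReal t < k x} := by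
    intro k
    apply Antitone.measurable
    intro s t hst
    exact measure_mono fun x hx => lt_of_le_of_lt (ENNReal.ofReal_le_ofReal hst) hx
  rw [← lintegral_add_left (hm f), ← lintegral_const_mul _ (hm _)]
  refine setLIntegral_mono ((hm _).const_mul _) fun t ht => ?_
  rcases lt_or_ge (ENNReal.ofReal t) 1 with h1 | h1
  · have hfn : {x | ENNReal.ofReal t < f x}.Nonempty := by
      rw [← hf1] at h1; exact lt_iSup_iff.1 h1
    have hgn : {x | ENNReal.ofReal t < g x}.Nonempty := by
      rw [← hg1] at h1; exact lt_iSup_iff.1 h1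
    refine brunn_minkowski_real (measurableSet_lt measurable_const hf)
      (measurableSet_lt measurable_const hg) hfn hgn fun x hx y hy => ?_
    simp only [mem_ofPred_eq] at hx hy ⊢
    refine lt_min ?_ h1
    by_contra! hc
    have := (H x y).trans (pow_le_pow_left₀ (by simp) hc 2)
    have h2 : ENNReal.ofReal t ^ 2 < f x * g y := by
      rw [sq]; exact ENNReal.mul_lt_mul hx hy
    exact absurd this (not_le.2 h2)
  · have e1 : {x | ENNReal.ofReal t < f x} = ∅ := by
      ext x; simpa using (hfle x).trans h1
    have e2 : {x | ENNReal.ofReal t < g x} = ∅ := by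
      ext x; simpa using (hgle x).trans h1
    simp [e1, e2]

theorem ENNReal.mul_le_sq_of_add_le_two_mul {a b c : ℝ≥0∞} (h : a + b ≤ 2 * c) :
    a * b ≤ c ^ 2 := by
  by_cases hc : c = ∞
  · simp [hc]
  have h2 : 2 * c ≠ ∞ := ENNReal.mul_ne_top (by simp) hc
  have ha : a ≠ ∞ := ne_top_of_le_ne_top h2 (le_self_add.trans h)
  have hb : b ≠ ∞ := ne_top_of_le_ne_top h2 (le_add_self.trans h)
  lift a to NNReal using ha
  lift b to NNReal using hb
  lift c to NNReal using hc
  norm_cast at h ⊢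
  have h' : (a : ℝ) + b ≤ 2 * c := by exact_mod_cast h
  have : (a : ℝ) * b ≤ c ^ 2 := by
    nlinarith [sq_nonneg ((a : ℝ) - b), a.2, b.2, c.2, NNReal.coe_nonneg a, NNReal.coe_nonneg b]
  exact_mod_cast this

theorem prekopaLeindler_real_of_bounded {f g h : ℝ → ℝ≥0∞} (hf : Measurable f)
    (hg : Measurable g) (hh : Measurable h)
    (hf1 : ⨆ x, f x ≠ ∞) (hg1 : ⨆ x, g x ≠ ∞)
    (H : ∀ x y, f x * g y ≤ h (2⁻¹ * (x + y)) ^ 2) :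
    (∫⁻ x, f x) * (∫⁻ x, g x) ≤ (∫⁻ x, h x) ^ 2 := by
  set a := ⨆ x, f x with ha
  set b := ⨆ x, g x with hb
  by_cases ha0 : a = 0
  · have : ∀ x, f x = 0 := fun x => by
      have := le_iSup f x
      rw [← ha, ha0] at this
      simpa using this
    simp [this]
  by_cases hb0 : b = 0
  · have : ∀ x, g x = 0 := fun x => by
      have := le_iSup g x
      rw [← hb, hb0] at this
      simpa using this
    simp [this]
  set c : ℝ≥0∞ := (a⁻¹ * b⁻¹) ^ (2⁻¹ : ℝ) with hc
  have hc2 : c ^ 2 = a⁻¹ * b⁻¹ := by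
    rw [hc, ← ENNReal.rpow_natCast, ← ENNReal.rpow_mul]; norm_num
  have h1 := prekopaLeindler_real_of_iSup_eq_one (f := fun x => a⁻¹ * f x)
    (g := fun x => b⁻¹ * g x) (h := fun x => c * h x) (hf.const_mul _) (hg.const_mul _)
    (hh.const_mul _)
    (by rw [← ENNReal.mul_iSup, ← ha, ENNReal.inv_mul_cancel ha0 hf1])
    (by rw [← ENNReal.mul_iSup, ← hb, ENNReal.inv_mul_cancel hb0 hg1])
    (fun x y => by
      rw [mul_pow, hc2, mul_mul_mul_comm]
      exact mul_le_mul_right (H x y) _)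
  have h2 := ENNReal.mul_le_sq_of_add_le_two_mul h1
  rw [lintegral_const_mul _ hf, lintegral_const_mul _ hg, lintegral_const_mul _ hh, mul_pow, hc2,
    mul_mul_mul_comm] at h2
  refine (ENNReal.mul_le_mul_iff_right ?_ ?_).1 h2
  · simp [hf1, hg1]
  · exact ENNReal.mul_ne_top (by simpa using ha0) (by simpa using hb0)

theorem prekopaLeindler_real : PrekopaLeindler ℝ := by
  intro f g h hf hg hh H
  simp only [smul_eq_mul] at H
  have hlim : ∀ k : ℝ → ℝ≥0∞, Measurable k →
      ∫⁻ x, k x = ⨆ n : ℕ, ∫⁻ x, min (k x) n := by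
    intro k hk
    rw [← lintegral_iSup (fun n => hk.min measurable_const)
      (fun m n hmn x => min_le_min le_rfl (by exact_mod_cast hmn))]
    refine lintegral_congr fun x => ?_
    rw [← inf_iSup_eq, ENNReal.iSup_natCast, inf_top_eq]
  rw [hlim f hf, hlim g hg]
  rw [ENNReal.iSup_mul]
  refine iSup_le fun i => ?_
  rw [ENNReal.mul_iSup]
  refine iSup_le fun j => ?_
  refine le_trans (b := (∫⁻ x, min (f x) (max i j : ℕ)) * ∫⁻ x, min (g x) (max i j : ℕ)) ?_ ?_
  swap
  · refine prekopaLeindler_real_of_bounded (hf.min measurable_const) (hg.min measurable_const) hh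
      ?_ ?_ fun x y => (mul_le_mul' (min_le_left _ _) (min_le_left _ _)).trans (H x y)
    · exact ne_top_of_le_ne_top (ENNReal.natCast_ne_top _) (iSup_le fun x => min_le_right _ _)
    · exact ne_top_of_le_ne_top (ENNReal.natCast_ne_top _) (iSup_le fun x => min_le_right _ _)
  · refine mul_le_mul' ?_ ?_
    · exact lintegral_mono fun x => min_le_min le_rfl (by exact_mod_cast le_max_left i j)
    · exact lintegral_mono fun x => min_le_min le_rfl (by exact_mod_cast le_max_right i j)

theorem PrekopaLeindler.prod {E F : Type*} [AddCommGroup E] [Module ℝ E] [MeasureSpace E]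
    [AddCommGroup F] [Module ℝ F] [MeasureSpace F] [SFinite (volume : Measure F)]
    (hE : PrekopaLeindler E) (hF : PrekopaLeindler F) : PrekopaLeindler (E × F) := by
  intro f g h hf hg hh H
  rw [Measure.volume_eq_prod, lintegral_prod _ hf.aemeasurable, lintegral_prod _ hg.aemeasurable,
    lintegral_prod _ hh.aemeasurable]
  refine hE _ _ _ hf.lintegral_prod_right' hg.lintegral_prod_right' hh.lintegral_prod_right' ?_
  intro x y
  exact hF _ _ _ (hf.comp measurable_prodMk_left) (hg.comp measurable_prodMk_left)
    (hh.comp measurable_prodMk_left) fun a b => H (x, a) (y, b)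

theorem PrekopaLeindler.of_measurePreserving {E F : Type*} [AddCommGroup E] [Module ℝ E]
    [MeasureSpace E] [AddCommGroup F] [Module ℝ F] [MeasureSpace F]
    (hE : PrekopaLeindler E) (e : E ≃ᵐ F) (he : MeasurePreserving e)
    (hlin : ∀ x y, e ((2⁻¹ : ℝ) • (x + y)) = (2⁻¹ : ℝ) • (e x + e y)) : PrekopaLeindler F := by
  intro f g h hf hg hh H
  rw [← he.lintegral_comp hf, ← he.lintegral_comp hg, ← he.lintegral_comp hh]
  refine hE _ _ _ (hf.comp e.measurable) (hg.comp e.measurable) (hh.comp e.measurable) ?_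
  intro x y
  rw [hlin]
  exact H _ _

theorem prekopaLeindler_pi : ∀ n : ℕ, PrekopaLeindler (Fin n → ℝ)
  | 0 => by
    intro f g h hf hg hh H
    simp only [volume_pi, Measure.pi_of_empty _ (0 : Fin 0 → ℝ), lintegral_dirac]
    have := H 0 0
    simpa using this
  | n + 1 => by
    refine (prekopaLeindler_real.prod (prekopaLeindler_pi n)).of_measurePreserving
      (MeasurableEquiv.piFinSuccAbove (fun _ => ℝ) 0).symm
      (volume_preserving_piFinSuccAbove (fun _ => ℝ) 0).symm ?_
    intro x y
    ext i
    refine Fin.cases ?_ (fun i => ?_) i <;> simp [MeasurableEquiv.piFinSuccAbove, mul_add]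

theorem prekopaLeindler_euclidean (d : ℕ) : PrekopaLeindler (Ed d) := by
  refine (prekopaLeindler_pi d).of_measurePreserving (MeasurableEquiv.toLp 2 (Fin d → ℝ))
    (PiLp.volume_preserving_toLp (Fin d)) fun x y => rfl

end PrekopaLeindler

section Minimizer
open Set Filter Topology

/-- Cyclical monotonicity of a subset of `E × E`. -/
def CyclicallyMonotone {E : Type*} [NormedAddCommGroup E] [InnerProductSpace ℝ E]
    (S : Set (E × E)) : Prop :=
  ∀ (n : ℕ) (p : Fin n → E × E) (τ : Equiv.Perm (Fin n)), (∀ i, p i ∈ S) →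
    ∑ i, ⟪(p (τ i)).1, (p i).2⟫ ≤ ∑ i, ⟪(p i).1, (p i).2⟫

/-- A maximizer of a linear functional over the transport polytope has cyclically monotone
support. -/
theorem exists_transport_matrix_cyclic {ι κ : Type*} [Fintype ι] [Fintype κ]
    (a : ι → ℝ) (b : κ → ℝ) (ha : ∀ i, 0 ≤ a i) (hb : ∀ j, 0 ≤ b j)
    (ha1 : ∑ i, a i = 1) (hb1 : ∑ j, b j = 1) (c : ι × κ → ℝ) :
    ∃ P : ι × κ → ℝ, (∀ p, 0 ≤ P p) ∧ (∀ i, ∑ j, P (i, j) = a i) ∧ (∀ j, ∑ i, P (i, j) = b j) ∧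
      ∀ (n : ℕ) (p : Fin n → ι × κ) (τ : Equiv.Perm (Fin n)), (∀ k, 0 < P (p k)) →
        ∑ k, c ((p (τ k)).1, (p k).2) ≤ ∑ k, c (p k) := by
  classical
  set T : Set (ι × κ → ℝ) := {P | (∀ p, 0 ≤ P p) ∧ (∀ i, ∑ j, P (i, j) = a i) ∧
    (∀ j, ∑ i, P (i, j) = b j)} with hT
  have hTc : IsCompact T := by
    refine (isCompact_Icc (a := (0 : ι × κ → ℝ)) (b := fun p => a p.1)).of_isClosed_subset ?_ ?_
    · have e : T = (⋂ p, {P | 0 ≤ P p}) ∩ ((⋂ i, {P | ∑ j, P (i, j) = a i}) ∩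
          (⋂ j, {P | ∑ i, P (i, j) = b j})) := by
        ext P; simp [hT]
      rw [e]
      refine (isClosed_iInter fun p => isClosed_le continuous_const (continuous_apply p)).inter
        ((isClosed_iInter fun i => isClosed_eq (by fun_prop) continuous_const).inter
          (isClosed_iInter fun j => isClosed_eq (by fun_prop) continuous_const))
    · rintro P ⟨h1, h2, -⟩
      refine ⟨fun p => h1 p, fun p => ?_⟩
      change P p ≤ a p.1
      rw [← h2 p.1]
      exact Finset.single_le_sum (f := fun j => P (p.1, j)) (fun j _ => h1 _) (Finset.mem_univ p.2)
  have hTn : T.Nonempty := by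
    refine ⟨fun p => a p.1 * b p.2, fun p => mul_nonneg (ha _) (hb _), fun i => ?_, fun j => ?_⟩
    · simp [← Finset.mul_sum, hb1]
    · simp [← Finset.sum_mul, ha1]
  obtain ⟨P, hPT, hPmax⟩ := hTc.exists_isMaxOn hTn
    (f := fun P => ∑ p, P p * c p) (by fun_prop)
  obtain ⟨hP0, hPa, hPb⟩ := hPT
  refine ⟨P, hP0, hPa, hPb, fun n p τ hp => ?_⟩
  rcases Nat.eq_zero_or_pos n with rfl | hn
  · simp
  have : Nonempty (Fin n) := ⟨⟨0, hn⟩⟩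
  obtain ⟨k₀, hk₀⟩ := Finite.exists_min fun k => P (p k)
  set ε : ℝ := P (p k₀) / n with hε
  have hn' : (0 : ℝ) < n := by exact_mod_cast hn
  have hε0 : 0 < ε := div_pos (hp _) hn'
  let N : ι × κ → ℝ := fun q => ∑ k, if p k = q then (1 : ℝ) else 0
  let M : ι × κ → ℝ := fun q => ∑ k, if ((p (τ k)).1, (p k).2) = q then (1 : ℝ) else 0
  have hN1 : ∀ i, ∑ j, N (i, j) = ∑ k, if (p k).1 = i then (1 : ℝ) else 0 := by
    intro i
    rw [Finset.sum_comm]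
    refine Finset.sum_congr rfl fun k _ => ?_
    simp only [Prod.ext_iff]
    by_cases h : (p k).1 = i <;> simp [h]
  have hN2 : ∀ j, ∑ i, N (i, j) = ∑ k, if (p k).2 = j then (1 : ℝ) else 0 := by
    intro j
    rw [Finset.sum_comm]
    refine Finset.sum_congr rfl fun k _ => ?_
    simp only [Prod.ext_iff]
    by_cases h : (p k).2 = j <;> simp [h]
  have hM1 : ∀ i, ∑ j, M (i, j) = ∑ k, if (p k).1 = i then (1 : ℝ) else 0 := by
    intro i
    rw [← Equiv.sum_comp τ, Finset.sum_comm]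
    refine Finset.sum_congr rfl fun k _ => ?_
    simp only [Prod.ext_iff]
    by_cases h : (p (τ k)).1 = i <;> simp [h]
  have hM2 : ∀ j, ∑ i, M (i, j) = ∑ k, if (p k).2 = j then (1 : ℝ) else 0 := by
    intro j
    rw [Finset.sum_comm]
    refine Finset.sum_congr rfl fun k _ => ?_
    simp only [Prod.ext_iff]
    by_cases h : (p k).2 = j <;> simp [h]
  have hmem : (fun q => P q + ε * (M q - N q)) ∈ T := by
    refine ⟨fun q => ?_, fun i => ?_, fun j => ?_⟩
    · have hM0 : 0 ≤ M q := Finset.sum_nonneg fun k _ => by split_ifs <;> norm_num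
      have hNq : ε * N q ≤ P q := by
        by_cases hq : ∃ k, p k = q
        · obtain ⟨k, rfl⟩ := hq
          have : N (p k) ≤ n := by
            calc N (p k) ≤ ∑ _l : Fin n, (1 : ℝ) :=
                  Finset.sum_le_sum fun l _ => by split_ifs <;> norm_num
              _ = n := by simp
          calc ε * N (p k) ≤ ε * n := mul_le_mul_of_nonneg_left this hε0.le
            _ = P (p k₀) := by rw [hε]; field_simp
            _ ≤ P (p k) := hk₀ k
        · have : N q = 0 := Finset.sum_eq_zero fun k _ => if_neg fun h => hq ⟨k, h⟩
          rw [this, mul_zero]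
          exact hP0 q
      have := mul_nonneg hε0.le hM0
      dsimp only
      linarith
    · simp only [Finset.sum_add_distrib, ← Finset.mul_sum, Finset.sum_sub_distrib, hM1, hN1, hPa]
      ring
    · simp only [Finset.sum_add_distrib, ← Finset.mul_sum, Finset.sum_sub_distrib, hM2, hN2, hPb]
      ring
  have hle := hPmax hmem
  simp only [mem_ofPred_eq] at hle
  have hMc : ∑ q, M q * c q = ∑ k, c ((p (τ k)).1, (p k).2) := by
    simp only [M, Finset.sum_mul]
    rw [Finset.sum_comm]
    simp
  have hNc : ∑ q, N q * c q = ∑ k, c (p k) := by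
    simp only [N, Finset.sum_mul]
    rw [Finset.sum_comm]
    simp
  have hexp : ∑ q, (P q + ε * (M q - N q)) * c q =
      ∑ q, P q * c q + ε * (∑ k, c ((p (τ k)).1, (p k).2) - ∑ k, c (p k)) := by
    rw [← hMc, ← hNc, ← Finset.sum_sub_distrib, Finset.mul_sum, ← Finset.sum_add_distrib]
    exact Finset.sum_congr rfl fun q _ => by ring
  rw [hexp] at hle
  nlinarith

section

variable {E : Type*} [NormedAddCommGroup E] [InnerProductSpace ℝ E] [MeasurableSpace E]
  [BorelSpace E]

theorem SimpleFunc.map_apply_eq_sum {Ω F : Type*} [MeasurableSpace Ω] [MeasurableSpace F]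
    (s : SimpleFunc Ω F) (hs : Measurable s) (σ : Measure Ω) {B : Set F} (hB : MeasurableSet B) :
    σ.map s B = ∑ x : s.range, σ (s ⁻¹' {(x : F)}) * B.indicator 1 (x : F) := by
  rw [Measure.map_apply hs hB]
  have h1 : σ (s ⁻¹' B) = ∫⁻ ω, (s.map (B.indicator (1 : F → ℝ≥0∞))) ω ∂σ := by
    rw [← lintegral_indicator_one (hs hB)]
    rfl
  rw [h1, SimpleFunc.lintegral_eq_lintegral, SimpleFunc.map_lintegral,
    ← Finset.sum_coe_sort s.range (fun x => B.indicator (1 : F → ℝ≥0∞) x * σ (s ⁻¹' {x}))]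
  exact Finset.sum_congr rfl fun x _ => mul_comm _ _

theorem exists_cyclicallyMonotone_coupling_simple (σ μ : Measure E) [IsProbabilityMeasure σ]
    [IsProbabilityMeasure μ] [SecondCountableTopology E] (s t : SimpleFunc E E) :
    ∃ (γ : Measure (E × E)) (S : Set (E × E)), IsProbabilityMeasure γ ∧
      γ.map Prod.fst = σ.map s ∧ γ.map Prod.snd = μ.map t ∧ γ Sᶜ = 0 ∧ CyclicallyMonotone S := by
  classical
  have hsum : ∀ (ν : Measure E) [IsProbabilityMeasure ν] (r : SimpleFunc E E),
      ∑ x : r.range, ν.real (r ⁻¹' {(x : E)}) = 1 := by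
    intro ν _ r
    have h := SimpleFunc.map_apply_eq_sum r r.measurable ν MeasurableSet.univ
    rw [Measure.map_apply r.measurable MeasurableSet.univ] at h
    simp only [preimage_univ, measure_univ, indicator_univ, Pi.one_apply, mul_one] at h
    have h' := congrArg ENNReal.toReal h
    rw [ENNReal.toReal_sum fun x _ => measure_ne_top _ _] at h'
    simpa [Measure.real] using h'.symm
  obtain ⟨P, hP0, hPa, hPb, hPc⟩ := exists_transport_matrix_cyclic
    (fun x : s.range => σ.real (s ⁻¹' {(x : E)})) (fun x : t.range => μ.real (t ⁻¹' {(x : E)}))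
    (fun _ => measureReal_nonneg) (fun _ => measureReal_nonneg) (hsum σ s) (hsum μ t)
    (fun p => ⟪(p.1 : E), (p.2 : E)⟫)
  let γ : Measure (E × E) := ∑ p : s.range × t.range,
    ENNReal.ofReal (P p) • Measure.dirac ((p.1 : E), (p.2 : E))
  have hγ : ∀ B, MeasurableSet B → γ B = ∑ p : s.range × t.range,
      ENNReal.ofReal (P p) * B.indicator 1 ((p.1 : E), (p.2 : E)) := by
    intro B hB
    simp [γ, Measure.dirac_apply' _ hB]
  have hfst : γ.map Prod.fst = σ.map s := by
    ext B hB
    rw [SimpleFunc.map_apply_eq_sum s s.measurable σ hB, Measure.map_apply measurable_fst hB,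
      hγ _ (measurable_fst hB), Fintype.sum_prod_type]
    refine Finset.sum_congr rfl fun i _ => ?_
    have : ∀ j : t.range, (Prod.fst ⁻¹' B).indicator (1 : E × E → ℝ≥0∞) ((i : E), (j : E)) =
      B.indicator 1 (i : E) := fun j => rfl
    simp only [this, ← Finset.sum_mul]
    rw [← ENNReal.ofReal_sum_of_nonneg fun j _ => hP0 _, hPa, ofReal_measureReal]
  have hsnd : γ.map Prod.snd = μ.map t := by
    ext B hB
    rw [SimpleFunc.map_apply_eq_sum t t.measurable μ hB, Measure.map_apply measurable_snd hB,
      hγ _ (measurable_snd hB), Fintype.sum_prod_type_right]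
    refine Finset.sum_congr rfl fun j _ => ?_
    have : ∀ i : s.range, (Prod.snd ⁻¹' B).indicator (1 : E × E → ℝ≥0∞) ((i : E), (j : E)) =
      B.indicator 1 (j : E) := fun j => rfl
    simp only [this, ← Finset.sum_mul]
    rw [← ENNReal.ofReal_sum_of_nonneg fun j _ => hP0 _, hPb, ofReal_measureReal]
  set S : Set (E × E) := (fun p : s.range × t.range => ((p.1 : E), (p.2 : E))) '' {p | 0 < P p}
    with hS
  refine ⟨γ, S, ⟨?_⟩, hfst, hsnd, ?_, ?_⟩
  · have h1 : γ univ = γ.map Prod.fst univ := by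
      rw [Measure.map_apply measurable_fst MeasurableSet.univ, preimage_univ]
    rw [h1, hfst, Measure.map_apply s.measurable MeasurableSet.univ, preimage_univ, measure_univ]
  · have hSm : MeasurableSet S := (Set.toFinite S).measurableSet
    rw [hγ _ hSm.compl]
    refine Finset.sum_eq_zero fun p _ => ?_
    rcases (hP0 p).eq_or_lt with h | h
    · simp [← h]
    · have : ((p.1 : E), (p.2 : E)) ∈ S := ⟨p, h, rfl⟩
      simp [this]
  · intro n p τ hp
    choose q hq hqp using hp
    have := hPc n q τ hq
    simp only [← hqp]
    exact this

theorem CyclicallyMonotone.support_of_tendsto [SecondCountableTopology E]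
    {γs : ℕ → ProbabilityMeasure (E × E)} {γ : ProbabilityMeasure (E × E)}
    (hγ : Tendsto γs atTop (𝓝 γ)) {S : ℕ → Set (E × E)}
    (hS : ∀ n, (γs n : Measure (E × E)) (S n)ᶜ = 0) (hcm : ∀ n, CyclicallyMonotone (S n)) :
    CyclicallyMonotone (γ : Measure (E × E)).support := by
  intro m p τ hp
  by_contra! hlt
  have hopen : IsOpen {q : Fin m → E × E |
      ∑ i, ⟪(q i).1, (q i).2⟫ < ∑ i, ⟪(q (τ i)).1, (q i).2⟫} :=
    isOpen_lt (by fun_prop) (by fun_prop)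
  obtain ⟨ε, hε, hball⟩ := Metric.isOpen_iff.1 hopen p hlt
  have hev : ∀ i, ∀ᶠ n in atTop, 0 < (γs n : Measure (E × E)) (Metric.ball (p i) ε) := by
    intro i
    have h1 := ProbabilityMeasure.le_liminf_measure_open_of_tendsto hγ
      (Metric.isOpen_ball (x := p i) (ε := ε))
    have h2 : 0 < (γ : Measure (E × E)) (Metric.ball (p i) ε) :=
      (Measure.mem_support_iff_forall (p i)).1 (hp i) _ (Metric.ball_mem_nhds _ hε)
    exact eventually_lt_of_lt_liminf (h2.trans_le h1)
  obtain ⟨n, hn⟩ := (eventually_all.2 hev).exists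
  have hex : ∀ i, ∃ q ∈ S n, q ∈ Metric.ball (p i) ε := by
    intro i
    by_contra! hcon
    have : Metric.ball (p i) ε ⊆ (S n)ᶜ := fun q hq hqS => hcon q hqS hq
    exact (hn i).ne' (measure_mono_null this (hS n))
  choose q hq hqb using hex
  have hqmem : q ∈ Metric.ball p ε := (mem_ball_iff_norm.2 <| (pi_norm_lt_iff hε).2 fun i =>
    mem_ball_iff_norm.1 (hqb i))
  exact absurd (hcm n m q τ hq) (not_le.2 (hball hqmem))

theorem exists_simpleFunc_tendsto {E : Type*} [NormedAddCommGroup E] [MeasurableSpace E]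
    [BorelSpace E] (σ : ProbabilityMeasure E) [SecondCountableTopology E] :
    ∃ s : ℕ → SimpleFunc E E, Tendsto
      (fun n => σ.map (s n).measurable.aemeasurable) atTop (𝓝 σ) := by
  refine ⟨SimpleFunc.approxOn id measurable_id univ 0 (mem_univ _), ?_⟩
  rw [ProbabilityMeasure.tendsto_iff_forall_integral_tendsto]
  intro f
  have h1 : ∀ n, ∫ x, f x ∂(σ.map
      (SimpleFunc.approxOn id measurable_id univ 0 (mem_univ _) n).measurable.aemeasurable :
        Measure E) =
      ∫ x, f (SimpleFunc.approxOn id measurable_id univ 0 (mem_univ _) n x) ∂(σ : Measure E) := by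
    intro n
    exact integral_map (SimpleFunc.measurable _).aemeasurable f.continuous.aestronglyMeasurable
  simp only [h1]
  refine tendsto_integral_of_dominated_convergence (fun _ => ‖f‖) (fun n => ?_)
    (integrable_const _) (fun n => Eventually.of_forall fun x => f.norm_coe_le_norm _)
    (Eventually.of_forall fun x => ?_)
  · exact (f.continuous.measurable.comp (SimpleFunc.measurable _)).aestronglyMeasurable
  · refine (f.continuous.tendsto _).comp ?_
    exact SimpleFunc.tendsto_approxOn measurable_id (mem_univ _) (by simp)

/-- Any two probability measures have a coupling with cyclically monotone support. -/
theorem exists_cyclicallyMonotone_coupling [CompleteSpace E] [SecondCountableTopology E]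
    (σ μ : Measure E) [hσ : IsProbabilityMeasure σ] [hμ : IsProbabilityMeasure μ] :
    ∃ γ : Measure (E × E), IsProbabilityMeasure γ ∧ γ.map Prod.fst = σ ∧ γ.map Prod.snd = μ ∧
      CyclicallyMonotone γ.support := by
  obtain ⟨s, hs⟩ := exists_simpleFunc_tendsto (⟨σ, hσ⟩ : ProbabilityMeasure E)
  obtain ⟨t, ht⟩ := exists_simpleFunc_tendsto (⟨μ, hμ⟩ : ProbabilityMeasure E)
  choose g S hg hgs hgt hgS hcm using
    fun n => exists_cyclicallyMonotone_coupling_simple σ μ (s n) (t n)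
  let γs : ℕ → ProbabilityMeasure (E × E) := fun n => ⟨g n, hg n⟩
  have tight : ∀ {νs : ℕ → ProbabilityMeasure E} {ν : ProbabilityMeasure E},
      Tendsto νs atTop (𝓝 ν) →
      IsTightMeasureSet {((ρ : ProbabilityMeasure E) : Measure E) | ρ ∈ range νs} := by
    intro νs ν h
    exact isTightMeasureSet_of_isCompact_closure
      (h.isCompact_insert_range.of_isClosed_subset isClosed_closure
        (closure_minimal (subset_insert _ _) h.isCompact_insert_range.isClosed))
  have hT : IsTightMeasureSet {((ρ : ProbabilityMeasure (E × E)) : Measure (E × E)) |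
      ρ ∈ range γs} := by
    refine IsTightMeasureSet.prodMk ((tight hs).subset ?_) ((tight ht).subset ?_)
    · rintro _ ⟨_, ⟨_, ⟨n, rfl⟩, rfl⟩, rfl⟩
      exact ⟨_, ⟨n, rfl⟩, (hgs n).symm⟩
    · rintro _ ⟨_, ⟨_, ⟨n, rfl⟩, rfl⟩, rfl⟩
      exact ⟨_, ⟨n, rfl⟩, (hgt n).symm⟩
  obtain ⟨γ, -, φ, hφ, hlim⟩ := (isCompact_closure_of_isTightMeasureSet hT).tendsto_subseq
    (x := γs) fun n => subset_closure ⟨n, rfl⟩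
  refine ⟨γ, inferInstance, ?_, ?_, CyclicallyMonotone.support_of_tendsto hlim
    (fun n => hgS (φ n)) (fun n => hcm (φ n))⟩
  · have h1 := ProbabilityMeasure.tendsto_map_of_tendsto_of_continuous _ _ hlim continuous_fst
    have h2 := hs.comp hφ.tendsto_atTop
    have e : ∀ n, ProbabilityMeasure.map ((γs ∘ φ) n)
        (measurable_fst : Measurable (Prod.fst : E × E → E)).aemeasurable =
        ProbabilityMeasure.map ⟨σ, hσ⟩ (s (φ n)).measurable.aemeasurable :=
      fun n => Subtype.ext (hgs (φ n))
    have h3 := tendsto_nhds_unique (h1.congr e) h2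
    exact congrArg Subtype.val h3
  · have h1 := ProbabilityMeasure.tendsto_map_of_tendsto_of_continuous _ _ hlim continuous_snd
    have h2 := ht.comp hφ.tendsto_atTop
    have e : ∀ n, ProbabilityMeasure.map ((γs ∘ φ) n)
        (measurable_snd : Measurable (Prod.snd : E × E → E)).aemeasurable =
        ProbabilityMeasure.map ⟨μ, hμ⟩ (t (φ n)).measurable.aemeasurable :=
      fun n => Subtype.ext (hgt (φ n))
    have h3 := tendsto_nhds_unique (h1.congr e) h2
    exact congrArg Subtype.val h3

end

section Rockafellar
variable {E : Type*} [NormedAddCommGroup E] [InnerProductSpace ℝ E]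

/-- The value at `z` of the Rockafellar chain `p 0, …, p n`. -/
def chainValue (n : ℕ) (p : ℕ → E × E) (z : E) : ℝ :=
  ∑ i ∈ Finset.range n, ⟪(p i).1, (p (i + 1)).2 - (p i).2⟫ + ⟪(p n).1, z - (p n).2⟫

theorem chainValue_start_nonpos {Γ : Set (E × E)} (hΓ : CyclicallyMonotone Γ) (n : ℕ)
    (p : ℕ → E × E) (hp : ∀ i, p i ∈ Γ) : chainValue n p (p 0).2 ≤ 0 := by
  have h := hΓ (n + 1) (fun i => p i) (finRotate (n + 1)).symm (fun i => hp i)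
  have e : ∑ i : Fin (n + 1), ⟪(p ((finRotate (n + 1)).symm i : Fin (n + 1))).1, (p i).2⟫ =
      ∑ i : Fin (n + 1), ⟪(p i).1, (p (finRotate (n + 1) i : Fin (n + 1))).2⟫ := by
    rw [← Equiv.sum_comp (finRotate (n + 1))]
    simp
  rw [e, Fin.sum_univ_castSucc, Fin.sum_univ_castSucc] at h
  simp only [finRotate_last, Fin.val_castSucc, Fin.val_last, Fin.val_zero] at h
  have e2 : ∀ i : Fin n, ((finRotate (n + 1) i.castSucc : Fin (n + 1)) : ℕ) = i + 1 := by
    intro i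
    simp
  simp only [e2] at h
  rw [Fin.sum_univ_eq_sum_range (fun i => ⟪(p i).1, (p (i + 1)).2⟫),
    Fin.sum_univ_eq_sum_range (fun i => ⟪(p i).1, (p i).2⟫)] at h
  simp only [chainValue, inner_sub_right, Finset.sum_sub_distrib]
  linarith

/-- Rockafellar's theorem: a cyclically monotone set is contained in the graph of the
subdifferential of a lower semicontinuous function. -/
theorem CyclicallyMonotone.exists_potential {Γ : Set (E × E)} (hΓ : CyclicallyMonotone Γ)
    (hne : Γ.Nonempty) :
    ∃ v : E → EReal, LowerSemicontinuous v ∧ (∀ z, v z ≠ ⊥) ∧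
      (∀ q ∈ Γ, v q.2 ≠ ⊤) ∧ ∀ q ∈ Γ, ∀ z, v q.2 + ((⟪q.1, z - q.2⟫ : ℝ) : EReal) ≤ v z := by
  obtain ⟨q₀, hq₀⟩ := hne
  let I := {c : ℕ × (ℕ → E × E) // c.2 0 = q₀ ∧ ∀ i, c.2 i ∈ Γ}
  let v : E → EReal := fun z => ⨆ c : I, ((chainValue c.1.1 c.1.2 z : ℝ) : EReal)
  have hext : ∀ q ∈ Γ, ∀ z, v q.2 + ((⟪q.1, z - q.2⟫ : ℝ) : EReal) ≤ v z := by
    intro q hq z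
    refine EReal.add_le_of_le_sub (iSup_le fun c => ?_)
    refine EReal.le_sub_iff_add_le (by simp) (by simp) |>.2 ?_
    let c' : I := ⟨(c.1.1 + 1, fun i => if i ≤ c.1.1 then c.1.2 i else q), by
      simpa using c.2.1, fun i => by
        dsimp only
        split_ifs
        · exact c.2.2 i
        · exact hq⟩
    refine le_trans (le_of_eq ?_)
      (le_iSup (fun c : I => ((chainValue c.1.1 c.1.2 z : ℝ) : EReal)) c')
    rw [← EReal.coe_add]
    congr 1
    simp only [chainValue, c', Finset.sum_range_succ, le_refl, if_true]
    simp only [add_le_iff_nonpos_right, nonpos_iff_eq_zero, one_ne_zero, if_false]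
    congr 2
    refine Finset.sum_congr rfl fun i hi => ?_
    have hi' := Finset.mem_range.1 hi
    rw [if_pos hi'.le, if_pos (Nat.succ_le_of_lt hi')]
  have hbot : ∀ z, v z ≠ ⊥ := fun z =>
    ((EReal.bot_lt_coe _).trans_le (le_iSup (fun c : I => ((chainValue c.1.1 c.1.2 z : ℝ) : EReal))
      ⟨(0, fun _ => q₀), rfl, fun _ => hq₀⟩)).ne'
  have h0 : v q₀.2 ≤ 0 := iSup_le fun c => by
    have := chainValue_start_nonpos hΓ c.1.1 c.1.2 c.2.2
    rw [c.2.1] at this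
    exact_mod_cast this
  refine ⟨v, lowerSemicontinuous_iSup fun c => ?_, hbot, fun q hq htop => ?_, hext⟩
  · refine (continuous_coe_real_ereal.comp ?_).lowerSemicontinuous
    unfold chainValue
    fun_prop
  · have := (hext q hq q₀.2).trans h0
    rw [htop, EReal.top_add_coe] at this
    exact absurd this (by simp)

end Rockafellar

section SignedIntegral
variable {X : Type*} [MeasurableSpace X] {ν : Measure X}

theorem sInt_eq_integral {g : X → ℝ} (hg : Integrable g ν) :
    sInt ν g = ((∫ x, g x ∂ν : ℝ) : EReal) := by
  have h1 : ∫⁻ x, ENNReal.ofReal (g x) ∂ν ≠ ⊤ := hg.lintegral_lt_top.ne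
  have h2 : ∫⁻ x, ENNReal.ofReal (-(g x)) ∂ν ≠ ⊤ := hg.neg.lintegral_lt_top.ne
  rw [integral_eq_lintegral_pos_part_sub_lintegral_neg_part hg, EReal.coe_sub,
    EReal.coe_ennreal_toReal h1, EReal.coe_ennreal_toReal h2, sInt]

theorem sInt_mono_ae {g h : X → ℝ} (hgh : g ≤ᵐ[ν] h) : sInt ν g ≤ sInt ν h := by
  refine EReal.sub_le_sub ?_ ?_
  · exact_mod_cast lintegral_mono_ae (hgh.mono fun x hx => ENNReal.ofReal_le_ofReal hx)
  · exact_mod_cast lintegral_mono_ae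
      (hgh.mono fun x hx => ENNReal.ofReal_le_ofReal (neg_le_neg hx))

theorem sInt_congr_ae {g h : X → ℝ} (hgh : g =ᵐ[ν] h) : sInt ν g = sInt ν h :=
  le_antisymm (sInt_mono_ae hgh.le) (sInt_mono_ae hgh.symm.le)

theorem lintegral_neg_ne_top {g l : X → ℝ} (hl : Integrable l ν) (hlg : l ≤ᵐ[ν] g) :
    ∫⁻ x, ENNReal.ofReal (-(g x)) ∂ν ≠ ⊤ :=
  ((lintegral_mono_ae (hlg.mono fun _ hx => ENNReal.ofReal_le_ofReal (neg_le_neg hx))).trans_lt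
    hl.neg.lintegral_lt_top).ne

theorem sInt_ne_bot {g l : X → ℝ} (hl : Integrable l ν) (hlg : l ≤ᵐ[ν] g) : sInt ν g ≠ ⊥ := by
  have h := (sInt_mono_ae hlg)
  rw [sInt_eq_integral hl] at h
  exact ((EReal.bot_lt_coe _).trans_le h).ne'

theorem integrable_of_sInt_ne_top {g l : X → ℝ} (hg : AEStronglyMeasurable g ν)
    (hl : Integrable l ν) (hlg : l ≤ᵐ[ν] g) (h : sInt ν g ≠ ⊤) : Integrable g ν := by
  have h2 := lintegral_neg_ne_top hl hlg
  have h1 : ∫⁻ x, ENNReal.ofReal (g x) ∂ν ≠ ⊤ := by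
    intro htop
    apply h
    rw [sInt, htop, ← EReal.coe_ennreal_toReal h2]
    exact EReal.top_sub_coe _
  refine ⟨hg, ?_⟩
  rw [hasFiniteIntegral_iff_norm]
  refine lt_of_le_of_lt (lintegral_mono fun x => ?_)
    ((lintegral_add_left' hg.aemeasurable.ennreal_ofReal _).trans_lt
      (ENNReal.add_lt_top.2 ⟨h1.lt_top, h2.lt_top⟩))
  rcases le_total 0 (g x) with hx | hx
  · simp [abs_of_nonneg hx]
  · simp [abs_of_nonpos hx]

theorem integrable_of_sandwich {g l m : X → ℝ} (hg : AEStronglyMeasurable g ν)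
    (hl : Integrable l ν) (hm : Integrable m ν) (hlg : l ≤ᵐ[ν] g) (hgm : g ≤ᵐ[ν] m) :
    Integrable g ν := by
  refine (hl.abs.add hm.abs).mono' hg ?_
  filter_upwards [hlg, hgm] with x h1 h2
  rw [Real.norm_eq_abs, abs_le]
  simp only [Pi.add_apply]
  constructor
  · linarith [neg_abs_le (l x), abs_nonneg (m x)]
  · linarith [le_abs_self (m x), abs_nonneg (l x)]

theorem EReal.coe_posPart {a : EReal} (h : a ≠ ⊤) : a.posPart = ENNReal.ofReal a.toReal := by
  simp [EReal.posPart, h]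

theorem eInt_eq_integral {f : X → EReal} (h1 : ∀ᵐ x ∂ν, f x ≠ ⊤) (h2 : ∀ᵐ x ∂ν, f x ≠ ⊥)
    (hf : Integrable (fun x => (f x).toReal) ν) :
    eInt ν f = ((∫ x, (f x).toReal ∂ν : ℝ) : EReal) := by
  rw [← sInt_eq_integral hf, eInt, sInt]
  congr 2
  · exact lintegral_congr_ae (h1.mono fun x hx => EReal.coe_posPart hx)
  · refine lintegral_congr_ae (h2.mono fun x hx => ?_)
    dsimp only
    rw [EReal.coe_posPart (by simpa using hx), _root_.EReal.toReal_neg_eq]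

end SignedIntegral

section SupAff
variable {d : ℕ}

/-- The supremum over `y ∈ S` of the affine functions `x ↦ ⟪x, y⟫ - ψ y`. -/
def supAff (S : Set (Ed d)) (ψ : Ed d → ℝ) (x : Ed d) : EReal :=
  ⨆ y ∈ S, ((⟪x, y⟫ - ψ y : ℝ) : EReal)

theorem le_supAff {S : Set (Ed d)} {ψ : Ed d → ℝ} {y : Ed d} (hy : y ∈ S) (x : Ed d) :
    ((⟪x, y⟫ - ψ y : ℝ) : EReal) ≤ supAff S ψ x :=
  le_iSup₂ (f := fun (y : Ed d) (_ : y ∈ S) => ((⟪x, y⟫ - ψ y : ℝ) : EReal)) y hy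

theorem supAff_le {S : Set (Ed d)} {ψ : Ed d → ℝ} {x : Ed d} {a : EReal}
    (h : ∀ y ∈ S, ((⟪x, y⟫ - ψ y : ℝ) : EReal) ≤ a) : supAff S ψ x ≤ a :=
  iSup₂_le h

theorem lowerSemicontinuous_supAff (S : Set (Ed d)) (ψ : Ed d → ℝ) :
    LowerSemicontinuous (supAff S ψ) := by
  refine lowerSemicontinuous_biSup fun y _ => ?_
  exact (continuous_coe_real_ereal.comp (by fun_prop)).lowerSemicontinuous

theorem measurable_supAff (S : Set (Ed d)) (ψ : Ed d → ℝ) : Measurable (supAff S ψ) :=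
  (lowerSemicontinuous_supAff S ψ).measurable

theorem supAff_ne_bot {S : Set (Ed d)} (hS : S.Nonempty) (ψ : Ed d → ℝ) (x : Ed d) :
    supAff S ψ x ≠ ⊥ := by
  obtain ⟨y, hy⟩ := hS
  exact ((EReal.bot_lt_coe _).trans_le (le_supAff hy x)).ne'

theorem le_supAff_toReal {S : Set (Ed d)} {ψ : Ed d → ℝ} {x y : Ed d} (hy : y ∈ S)
    (hx : supAff S ψ x ≠ ⊤) : ⟪x, y⟫ - ψ y ≤ (supAff S ψ x).toReal := by
  have h := le_supAff (ψ := ψ) hy x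
  rw [← EReal.coe_toReal hx (supAff_ne_bot ⟨y, hy⟩ ψ x)] at h
  exact_mod_cast h

theorem econvexOn_supAff (S : Set (Ed d)) (ψ : Ed d → ℝ) : EConvexOn (supAff S ψ) := by
  intro x y s t hs ht hst
  refine supAff_le fun z hz => ?_
  have e : ((⟪s • x + t • y, z⟫ - ψ z : ℝ) : EReal) =
      (s : EReal) * ((⟪x, z⟫ - ψ z : ℝ) : EReal) + (t : EReal) * ((⟪y, z⟫ - ψ z : ℝ) : EReal) := by
    rw [← EReal.coe_mul, ← EReal.coe_mul, ← EReal.coe_add]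
    congr 1
    rw [inner_add_left, real_inner_smul_left, real_inner_smul_left]
    linear_combination ψ z * hst
  rw [e]
  exact add_le_add (mul_le_mul_of_nonneg_left (le_supAff hz x) (by exact_mod_cast hs))
    (mul_le_mul_of_nonneg_left (le_supAff hz y) (by exact_mod_cast ht))

end SupAff

section Duality
variable {d : ℕ} {σ μ : Measure (Ed d)}

theorem integrable_id_of_mem_P1 (h : σ ∈ P1 d) : Integrable (fun x => x) σ :=
  (integrable_norm_iff (by fun_prop)).1 h.2

theorem coupling_integrable_fst {γ : Measure (Ed d × Ed d)} (hγ : γ ∈ couplings σ μ)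
    {f : Ed d → ℝ} (hf : Integrable f σ) : Integrable (fun q => f q.1) γ := by
  rw [← hγ.2.1] at hf
  exact hf.comp_measurable measurable_fst

theorem coupling_integrable_snd {γ : Measure (Ed d × Ed d)} (hγ : γ ∈ couplings σ μ)
    {f : Ed d → ℝ} (hf : Integrable f μ) : Integrable (fun q => f q.2) γ := by
  rw [← hγ.2.2] at hf
  exact hf.comp_measurable measurable_snd

theorem coupling_integral_fst {γ : Measure (Ed d × Ed d)} (hγ : γ ∈ couplings σ μ)
    {f : Ed d → ℝ} (hf : Integrable f σ) : ∫ q, f q.1 ∂γ = ∫ x, f x ∂σ := by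
  rw [← hγ.2.1] at hf ⊢
  exact (integral_map measurable_fst.aemeasurable hf.aestronglyMeasurable).symm

theorem coupling_integral_snd {γ : Measure (Ed d × Ed d)} (hγ : γ ∈ couplings σ μ)
    {f : Ed d → ℝ} (hf : Integrable f μ) : ∫ q, f q.2 ∂γ = ∫ x, f x ∂μ := by
  rw [← hγ.2.2] at hf ⊢
  exact (integral_map measurable_snd.aemeasurable hf.aestronglyMeasurable).symm

theorem coupling_ae_fst {γ : Measure (Ed d × Ed d)} (hγ : γ ∈ couplings σ μ)
    {P : Ed d → Prop} (h : ∀ᵐ x ∂σ, P x) : ∀ᵐ q ∂γ, P q.1 := by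
  rw [← hγ.2.1] at h
  exact ae_of_ae_map measurable_fst.aemeasurable h

theorem coupling_ae_snd {γ : Measure (Ed d × Ed d)} (hγ : γ ∈ couplings σ μ)
    {P : Ed d → Prop} (h : ∀ᵐ x ∂μ, P x) : ∀ᵐ q ∂γ, P q.2 := by
  rw [← hγ.2.2] at h
  exact ae_of_ae_map measurable_snd.aemeasurable h

theorem prod_mem_couplings [IsProbabilityMeasure σ] [IsProbabilityMeasure μ] :
    σ.prod μ ∈ couplings σ μ :=
  ⟨inferInstance, Measure.fst_prod, Measure.snd_prod⟩

theorem le_maxCorr {γ : Measure (Ed d × Ed d)} (hγ : γ ∈ couplings σ μ) :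
    sInt γ (fun p => ⟪p.1, p.2⟫) ≤ maxCorr σ μ :=
  le_iSup₂ (f := fun (γ : Measure (Ed d × Ed d)) (_ : γ ∈ couplings σ μ) =>
    sInt γ (fun p => ⟪p.1, p.2⟫)) γ hγ

theorem maxCorr_ne_bot (hσ : σ ∈ P1 d) (hμ : μ ∈ P1 d) : maxCorr σ μ ≠ ⊥ := by
  have := hσ.1
  have := hμ.1
  refine ne_bot_of_le_ne_bot ?_ (le_maxCorr prod_mem_couplings)
  refine sInt_ne_bot (l := fun p => -(‖p.1‖ * ‖p.2‖)) (hσ.2.mul_prod hμ.2).neg ?_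
  exact Eventually.of_forall fun p => (abs_le.1 (abs_real_inner_le_norm _ _)).1

theorem maxCorr_le {S : Set (Ed d)} {ψ : Ed d → ℝ} (hS : ∀ᵐ y ∂μ, y ∈ S)
    (hψ : Integrable ψ μ) (hfin : ∀ᵐ x ∂σ, supAff S ψ x ≠ ⊤)
    (hU : Integrable (fun x => (supAff S ψ x).toReal) σ) :
    maxCorr σ μ ≤ ((∫ x, (supAff S ψ x).toReal ∂σ + ∫ y, ψ y ∂μ : ℝ) : EReal) := by
  refine iSup₂_le fun γ hγ => ?_
  have h1 := coupling_integrable_fst hγ hU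
  have h2 := coupling_integrable_snd hγ hψ
  have h3 : Integrable (fun q : Ed d × Ed d => (supAff S ψ q.1).toReal + ψ q.2) γ := h1.add h2
  have e : ∫ x, (supAff S ψ x).toReal ∂σ + ∫ y, ψ y ∂μ =
      ∫ q : Ed d × Ed d, ((supAff S ψ q.1).toReal + ψ q.2) ∂γ := by
    rw [← coupling_integral_fst hγ hU, ← coupling_integral_snd hγ hψ, ← integral_add h1 h2]
  rw [e, ← sInt_eq_integral h3]
  refine sInt_mono_ae ?_
  filter_upwards [coupling_ae_fst hγ hfin, coupling_ae_snd hγ hS] with q hq1 hq2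
  have := le_supAff_toReal (ψ := ψ) hq2 hq1
  linarith

/-- Existence of optimal dual potentials for the maximal correlation problem. -/
theorem exists_dual_potential (hσ : σ ∈ P1 d) (hμ : μ ∈ P1 d) (hT : maxCorr σ μ ≠ ⊤) :
    ∃ (S : Set (Ed d)) (ψ : Ed d → ℝ), (∀ᵐ y ∂μ, y ∈ S) ∧ Integrable ψ μ ∧
      (∀ᵐ x ∂σ, supAff S ψ x ≠ ⊤) ∧ Integrable (fun x => (supAff S ψ x).toReal) σ ∧
      maxCorr σ μ = ((∫ x, (supAff S ψ x).toReal ∂σ + ∫ y, ψ y ∂μ : ℝ) : EReal) := by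
  have := hσ.1
  have := hμ.1
  obtain ⟨γ, hγp, hγ1, hγ2, hcm⟩ := exists_cyclicallyMonotone_coupling σ μ
  have hγ : γ ∈ couplings σ μ := ⟨hγp, hγ1, hγ2⟩
  have hae : ∀ᵐ q ∂γ, q ∈ γ.support := Measure.support_mem_ae
  obtain ⟨q₀, hq₀⟩ := hae.exists
  obtain ⟨v, hvl, hvb, hvt, hv⟩ := hcm.exists_potential ⟨q₀, hq₀⟩
  set S : Set (Ed d) := {y | v y ≠ ⊤} with hSdef
  set ψ : Ed d → ℝ := fun y => (v y).toReal with hψdef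
  have hvm : Measurable v := hvl.measurable
  have hψm : Measurable ψ := hvm.ereal_toReal
  have hSm : MeasurableSet S := (hvm (measurableSet_singleton ⊤)).compl
  have hcoe : ∀ y ∈ S, ((ψ y : ℝ) : EReal) = v y := fun y hy => EReal.coe_toReal hy (hvb y)
  have hsub : ∀ q ∈ γ.support, ∀ y ∈ S, ψ q.2 + ⟪q.1, y - q.2⟫ ≤ ψ y := by
    intro q hq y hy
    have h := hv q hq y
    rw [← hcoe y hy, ← hcoe q.2 (hvt q hq)] at h
    exact_mod_cast h
  have hUeq : ∀ q ∈ γ.support, supAff S ψ q.1 = ((⟪q.1, q.2⟫ - ψ q.2 : ℝ) : EReal) := by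
    intro q hq
    refine le_antisymm (supAff_le fun y hy => ?_) (le_supAff (hvt q hq) q.1)
    have h := hsub q hq y hy
    rw [inner_sub_right] at h
    exact_mod_cast (by linarith : ⟪q.1, y⟫ - ψ y ≤ ⟪q.1, q.2⟫ - ψ q.2)
  have hS : ∀ᵐ y ∂μ, y ∈ S := by
    rw [← hγ2]
    refine (ae_map_iff measurable_snd.aemeasurable hSm).2 ?_
    exact hae.mono fun q hq => hvt q hq
  have hUm := measurable_supAff S ψ
  have hfin : ∀ᵐ x ∂σ, supAff S ψ x ≠ ⊤ := by
    rw [← hγ1]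
    refine (ae_map_iff measurable_fst.aemeasurable
      (hUm (measurableSet_singleton ⊤)).compl).2 ?_
    exact hae.mono fun q hq => by
      change supAff S ψ q.1 ≠ ⊤
      rw [hUeq q hq]; exact EReal.coe_ne_top _
  have hUr : ∀ q ∈ γ.support, (supAff S ψ q.1).toReal = ⟪q.1, q.2⟫ - ψ q.2 := fun q hq => by
    rw [hUeq q hq, EReal.toReal_coe]
  set l₁ : Ed d → ℝ := fun x => ⟪x, q₀.2⟫ - ψ q₀.2 with hl₁
  set l₂ : Ed d → ℝ := fun y => ψ q₀.2 + ⟪q₀.1, y - q₀.2⟫ with hl₂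
  have hl₁i : Integrable (fun q : Ed d × Ed d => l₁ q.1) γ := coupling_integrable_fst hγ
    (((integrable_id_of_mem_P1 hσ).inner_const _).sub (integrable_const _))
  have hl₂i : Integrable (fun q : Ed d × Ed d => l₂ q.2) γ := coupling_integrable_snd hγ
    ((integrable_const _).add
      (((integrable_id_of_mem_P1 hμ).sub (integrable_const _)).const_inner _))
  have b1 : ∀ q ∈ γ.support, l₁ q.1 ≤ ⟪q.1, q.2⟫ - ψ q.2 := fun q hq => by
    rw [← hUr q hq]
    exact le_supAff_toReal (hvt q₀ hq₀) (by rw [hUeq q hq]; exact EReal.coe_ne_top _)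
  have b2 : ∀ q ∈ γ.support, l₂ q.2 ≤ ψ q.2 := fun q hq => hsub q₀ hq₀ q.2 (hvt q hq)
  have hcm : Measurable fun q : Ed d × Ed d => ⟪q.1, q.2⟫ := by fun_prop
  have hci : Integrable (fun q : Ed d × Ed d => ⟪q.1, q.2⟫) γ := by
    refine integrable_of_sInt_ne_top hcm.aestronglyMeasurable (hl₁i.add hl₂i) ?_
      (ne_top_of_le_ne_top hT (le_maxCorr hγ))
    filter_upwards [hae] with q hq
    have := b1 q hq
    have := b2 q hq
    simp only [Pi.add_apply]
    linarith
  have hψi' : Integrable (fun q : Ed d × Ed d => ψ q.2) γ := by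
    refine integrable_of_sandwich (hψm.comp measurable_snd).aestronglyMeasurable hl₂i
      (hci.sub hl₁i) (hae.mono fun q hq => b2 q hq) (hae.mono fun q hq => ?_)
    have := b1 q hq
    simp only [Pi.sub_apply]
    linarith
  have hUi' : Integrable (fun q : Ed d × Ed d => (supAff S ψ q.1).toReal) γ :=
    (hci.sub hψi').congr (hae.mono fun q hq => (hUr q hq).symm)
  have hψi : Integrable ψ μ := by
    rw [← hγ2]
    exact (integrable_map_measure hψm.aestronglyMeasurable measurable_snd.aemeasurable).2 hψi'
  have hUi : Integrable (fun x => (supAff S ψ x).toReal) σ := by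
    rw [← hγ1]
    exact (integrable_map_measure hUm.ereal_toReal.aestronglyMeasurable
      measurable_fst.aemeasurable).2 hUi'
  refine ⟨S, ψ, hS, hψi, hfin, hUi, le_antisymm (maxCorr_le hS hψi hfin hUi) ?_⟩
  refine le_trans (le_of_eq ?_) (le_maxCorr hγ)
  rw [sInt_eq_integral hci, ← coupling_integral_fst hγ hUi, ← coupling_integral_snd hγ hψi,
    ← integral_add hUi' hψi']
  congr 1
  refine integral_congr_ae (hae.mono fun q hq => ?_)
  dsimp only
  rw [hUr q hq]
  ring

end Duality

section Potentials
variable {d : ℕ} {α : ℝ} {μ : Measure (Ed d)}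

/-- The Gaussian-regularized exponential of the affine function attached to `(y, ψ y)`. -/
def wexp (α : ℝ) (ψ : Ed d → ℝ) (x y : Ed d) : ℝ≥0∞ :=
  ENNReal.ofReal (Real.exp (ψ y - ⟪x, y⟫ - (α / 2) * ‖x‖ ^ 2))

theorem measurable_gdens {u : Ed d → EReal} (hu : Measurable u) : Measurable (gdens α u) := by
  refine Measurable.ite (hu (measurableSet_singleton ⊤)) measurable_const ?_
  have := hu.ereal_toReal
  fun_prop

theorem gdens_supAff_le {S : Set (Ed d)} {ψ : Ed d → ℝ} {y : Ed d} (hy : y ∈ S) (x : Ed d) :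
    gdens α (supAff S ψ) x ≤ wexp α ψ x y := by
  unfold gdens wexp
  split_ifs with h
  · exact zero_le
  · have := le_supAff_toReal (ψ := ψ) hy h
    gcongr
    linarith

theorem le_gdens_supAff {S : Set (Ed d)} {ψ : Ed d → ℝ} {x : Ed d} {L : ℝ≥0∞} (hS : S.Nonempty)
    (h : ∀ y ∈ S, L ≤ wexp α ψ x y) : L ≤ gdens α (supAff S ψ) x := by
  rcases eq_or_ne L 0 with rfl | hL
  · exact zero_le
  obtain ⟨y₀, hy₀⟩ := hS
  have hLt : L ≠ ⊤ := ne_top_of_le_ne_top ENNReal.ofReal_ne_top (h y₀ hy₀)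
  have hLpos : 0 < L.toReal := ENNReal.toReal_pos hL hLt
  have key : ∀ y ∈ S, ⟪x, y⟫ - ψ y ≤ -Real.log L.toReal - (α / 2) * ‖x‖ ^ 2 := by
    intro y hy
    have h1 := ENNReal.toReal_mono ENNReal.ofReal_ne_top (h y hy)
    rw [ENNReal.toReal_ofReal (Real.exp_pos _).le] at h1
    have h2 := (Real.log_le_iff_le_exp hLpos).2 h1
    linarith
  have hU : supAff S ψ x ≤ ((-Real.log L.toReal - (α / 2) * ‖x‖ ^ 2 : ℝ) : EReal) :=
    supAff_le fun y hy => by exact_mod_cast key y hy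
  have hUt : supAff S ψ x ≠ ⊤ := ne_top_of_le_ne_top (EReal.coe_ne_top _) hU
  have hUr : (supAff S ψ x).toReal ≤ -Real.log L.toReal - (α / 2) * ‖x‖ ^ 2 := by
    rw [← EReal.coe_toReal hUt (supAff_ne_bot ⟨y₀, hy₀⟩ ψ x)] at hU
    exact_mod_cast hU
  rw [gdens, if_neg hUt, ← ENNReal.ofReal_toReal hLt]
  refine ENNReal.ofReal_le_ofReal ?_
  rw [← Real.log_le_iff_le_exp hLpos]
  linarith

/-- Admissible normalized dual potentials. -/
structure Admissible (μ : Measure (Ed d)) (S : Set (Ed d)) (ψ : Ed d → ℝ) : Prop where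
  ae_mem : ∀ᵐ y ∂μ, y ∈ S
  integrable : Integrable ψ μ
  integral_eq : ∫ y, ψ y ∂μ = 0

theorem Admissible.nonempty [IsProbabilityMeasure μ] {S : Set (Ed d)} {ψ : Ed d → ℝ}
    (h : Admissible μ S ψ) : S.Nonempty :=
  h.ae_mem.exists

theorem Admissible.midpoint {S₀ S₁ : Set (Ed d)} {ψ₀ ψ₁ : Ed d → ℝ}
    (h₀ : Admissible μ S₀ ψ₀) (h₁ : Admissible μ S₁ ψ₁) :
    Admissible μ (S₀ ∩ S₁) (fun y => (ψ₀ y + ψ₁ y) / 2) where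
  ae_mem := h₀.ae_mem.and h₁.ae_mem
  integrable := (h₀.integrable.add h₁.integrable).div_const 2
  integral_eq := by
    rw [integral_div, integral_add h₀.integrable h₁.integrable, h₀.integral_eq, h₁.integral_eq]
    simp

/-- The partition function of a potential. -/
def partFun (α : ℝ) (S : Set (Ed d)) (ψ : Ed d → ℝ) : ℝ≥0∞ := ∫⁻ x, gdens α (supAff S ψ) x

theorem Admissible.inner_bary_le (hμ : μ ∈ P1 d) {S : Set (Ed d)} {ψ : Ed d → ℝ}
    (h : Admissible μ S ψ) {x : Ed d} (hx : supAff S ψ x ≠ ⊤) :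
    ⟪x, bary μ⟫ ≤ (supAff S ψ x).toReal := by
  have := hμ.1
  have hi : Integrable (fun y => ⟪x, y⟫) μ := (integrable_id_of_mem_P1 hμ).const_inner x
  have h1 : ∫ y, (⟪x, y⟫ - ψ y) ∂μ ≤ ∫ _, (supAff S ψ x).toReal ∂μ :=
    integral_mono_ae (hi.sub h.integrable) (integrable_const _)
      (h.ae_mem.mono fun y hy => le_supAff_toReal hy hx)
  rw [integral_sub hi h.integrable, h.integral_eq,
    integral_inner (integrable_id_of_mem_P1 hμ)] at h1
  simpa [bary] using h1

/-- An integrable function dominating all densities of admissible potentials. -/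
def domDens (α : ℝ) (b x : Ed d) : ℝ := Real.exp (-⟪x, b⟫ - (α / 2) * ‖x‖ ^ 2)

theorem integrable_domDens (hα : 0 < α) (b : Ed d) : Integrable (domDens α b) := by
  have h := (GaussianFourier.integrable_cexp_neg_mul_sq_norm_add (V := Ed d)
    (b := ((α / 2 : ℝ) : ℂ)) (by simpa using hα) (-1) b).norm
  refine h.congr (Eventually.of_forall fun x => ?_)
  have e : (-((α / 2 : ℝ) : ℂ) * (‖x‖ : ℂ) ^ 2 + (-1) * ((⟪b, x⟫ : ℝ) : ℂ)) =
      ((-⟪x, b⟫ - (α / 2) * ‖x‖ ^ 2 : ℝ) : ℂ) := by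
    rw [real_inner_comm]; push_cast; ring
  dsimp only
  rw [e, Complex.norm_exp, Complex.ofReal_re, domDens]

theorem Admissible.gdens_le (hμ : μ ∈ P1 d) {S : Set (Ed d)} {ψ : Ed d → ℝ}
    (h : Admissible μ S ψ) (x : Ed d) :
    gdens α (supAff S ψ) x ≤ ENNReal.ofReal (domDens α (bary μ) x) := by
  unfold gdens domDens
  split_ifs with hx
  · exact zero_le
  · have := h.inner_bary_le hμ hx
    gcongr

/-- The supremum of the partition function over admissible potentials. -/
def maxPart (α : ℝ) (μ : Measure (Ed d)) : ℝ≥0∞ :=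
  ⨆ (S : Set (Ed d)) (ψ : Ed d → ℝ) (_ : Admissible μ S ψ), partFun α S ψ

theorem Admissible.partFun_le {S : Set (Ed d)} {ψ : Ed d → ℝ} (h : Admissible μ S ψ) :
    partFun α S ψ ≤ maxPart α μ :=
  le_iSup_of_le S (le_iSup_of_le ψ (le_iSup_of_le h le_rfl))

theorem maxPart_ne_top (hα : 0 < α) (hμ : μ ∈ P1 d) : maxPart α μ ≠ ⊤ := by
  refine ne_top_of_le_ne_top (integrable_domDens hα (bary μ)).lintegral_lt_top.ne ?_
  exact iSup_le fun S => iSup_le fun ψ => iSup_le fun h =>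
    lintegral_mono fun x => h.gdens_le hμ x

theorem maxPart_ne_zero (hα : 0 < α) (hμ : μ ∈ P1 d) : maxPart α μ ≠ 0 := by
  have := hμ.1
  set m := ∫ y, ‖y‖ ∂μ
  have hadm : Admissible μ univ (fun y => ‖y‖ - m) :=
    ⟨by simp, hμ.2.sub (integrable_const _), by
      rw [integral_sub hμ.2 (integrable_const _)]; simp [m]⟩
  refine (lt_of_lt_of_le ?_ (hadm.partFun_le (α := α))).ne'
  have hb : ∀ x ∈ Metric.ball (0 : Ed d) 1,
      ENNReal.ofReal (Real.exp (-m - α / 2)) ≤ gdens α (supAff univ fun y => ‖y‖ - m) x := by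
    intro x hx
    have hx1 : ‖x‖ ≤ 1 := (mem_ball_zero_iff.1 hx).le
    refine le_gdens_supAff univ_nonempty fun y _ => ?_
    refine ENNReal.ofReal_le_ofReal (Real.exp_le_exp.2 ?_)
    have h1 : ⟪x, y⟫ ≤ ‖y‖ := (real_inner_le_norm x y).trans
      (mul_le_of_le_one_left (norm_nonneg _) hx1)
    have h2 : ‖x‖ ^ 2 ≤ 1 := pow_le_one₀ (norm_nonneg _) hx1
    nlinarith
  calc (0 : ℝ≥0∞) < ENNReal.ofReal (Real.exp (-m - α / 2)) * volume (Metric.ball (0 : Ed d) 1) :=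
        ENNReal.mul_pos (by simp [Real.exp_pos]) (Metric.measure_ball_pos _ _ one_pos).ne'
    _ = ∫⁻ _ in Metric.ball (0 : Ed d) 1, ENNReal.ofReal (Real.exp (-m - α / 2)) := by simp
    _ ≤ ∫⁻ x in Metric.ball (0 : Ed d) 1, gdens α (supAff univ fun y => ‖y‖ - m) x :=
        setLIntegral_mono' measurableSet_ball hb
    _ ≤ _ := setLIntegral_le_lintegral _ _

theorem norm_sq_add_norm_sq_eq (x y : Ed d) :
    ‖x‖ ^ 2 + ‖y‖ ^ 2 = 2 * ‖(2⁻¹ : ℝ) • (x + y)‖ ^ 2 + ‖x - y‖ ^ 2 / 2 := by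
  have h := parallelogram_law_with_norm ℝ x y
  rw [norm_smul, mul_pow, Real.norm_of_nonneg (by norm_num)]
  nlinarith

/-- Prékopa–Leindler for Gaussian-regularized potentials, with the gain due to strong
convexity. -/
theorem lintegral_gdens_mul_le {S₀ S₁ : Set (Ed d)} {ψ₀ ψ₁ : Ed d → ℝ}
    (hS : (S₀ ∩ S₁).Nonempty) {a b : Ed d → ℝ} (ha : Measurable a) (hb : Measurable b)
    (hab : ∀ x y, a x + b y ≤ α / 8 * ‖x - y‖ ^ 2) :
    (∫⁻ x, gdens α (supAff S₀ ψ₀) x * ENNReal.ofReal (Real.exp (2 * a x))) *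
      (∫⁻ x, gdens α (supAff S₁ ψ₁) x * ENNReal.ofReal (Real.exp (2 * b x))) ≤
      partFun α (S₀ ∩ S₁) (fun y => (ψ₀ y + ψ₁ y) / 2) ^ 2 := by
  refine prekopaLeindler_euclidean d _ _ _
    ((measurable_gdens (measurable_supAff _ _)).mul (by fun_prop))
    ((measurable_gdens (measurable_supAff _ _)).mul (by fun_prop))
    (measurable_gdens (measurable_supAff _ _)) fun x y => ?_
  set P := gdens α (supAff S₀ ψ₀) x * ENNReal.ofReal (Real.exp (2 * a x)) *
    (gdens α (supAff S₁ ψ₁) y * ENNReal.ofReal (Real.exp (2 * b y))) with hP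
  have hPP : (P ^ (2⁻¹ : ℝ)) ^ 2 = P := by
    rw [← ENNReal.rpow_natCast, ← ENNReal.rpow_mul]; norm_num
  rw [← hPP]
  gcongr
  refine le_gdens_supAff hS fun z hz => ?_
  rw [← not_lt]
  intro hlt
  refine absurd ?_ (not_le.2 (ENNReal.pow_lt_pow_left two_ne_zero hlt))
  rw [hPP]
  calc P ≤ wexp α ψ₀ x z * ENNReal.ofReal (Real.exp (2 * a x)) *
        (wexp α ψ₁ y z * ENNReal.ofReal (Real.exp (2 * b y))) := by
        rw [hP]
        gcongr
        · exact gdens_supAff_le hz.1 x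
        · exact gdens_supAff_le hz.2 y
    _ ≤ wexp α (fun y => (ψ₀ y + ψ₁ y) / 2) ((2⁻¹ : ℝ) • (x + y)) z ^ 2 := by
        unfold wexp
        rw [← ENNReal.ofReal_mul (Real.exp_pos _).le, ← ENNReal.ofReal_mul (Real.exp_pos _).le,
          ← ENNReal.ofReal_mul (by positivity), ← ENNReal.ofReal_pow (Real.exp_pos _).le,
          ← Real.exp_add, ← Real.exp_add, ← Real.exp_add, ← Real.exp_nat_mul]
        refine ENNReal.ofReal_le_ofReal (Real.exp_le_exp.2 ?_)
        have h1 := norm_sq_add_norm_sq_eq x y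
        have h2 := hab x y
        have h3 : α * (‖x‖ ^ 2 + ‖y‖ ^ 2) =
          α * (2 * ‖(2⁻¹ : ℝ) • (x + y)‖ ^ 2 + ‖x - y‖ ^ 2 / 2) := by rw [h1]
        rw [real_inner_smul_left, inner_add_left]
        push_cast
        nlinarith

end Potentials

section Limits
variable {X : Type*} [MeasurableSpace X] {ν : Measure X}

theorem exists_subseq_ae_tendsto_of_sq_cauchy [IsProbabilityMeasure ν] {e : ℕ → X → ℝ}
    (he : ∀ n, AEStronglyMeasurable (e n) ν) (hb : ∀ n, ∀ᵐ x ∂ν, |e n x| ≤ 1)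
    (hc : ∀ δ > 0, ∃ N, ∀ n ≥ N, ∀ m ≥ N, ∫ x, (e n x - e m x) ^ 2 ∂ν ≤ δ) :
    ∃ φ : ℕ → ℕ, StrictMono φ ∧
      ∀ᵐ x ∂ν, ∃ l, Tendsto (fun k => e (φ k) x) atTop (𝓝 l) := by
  have hei : ∀ n, Integrable (e n) ν := fun n =>
    (integrable_const (1 : ℝ)).mono' (he n) (hb n)
  have key : ∀ δ > 0, ∀ n m, ∫ x, (e n x - e m x) ^ 2 ∂ν ≤ δ ^ 2 →
      eLpNorm (e n - e m) 1 ν ≤ ENNReal.ofReal δ := by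
    intro δ hδ n m h
    have hsq : Integrable (fun x => (e n x - e m x) ^ 2) ν := by
      refine (integrable_const (4 : ℝ)).mono' (((he n).sub (he m)).pow 2) ?_
      filter_upwards [hb n, hb m] with x h1 h2
      rw [Real.norm_of_nonneg (sq_nonneg _)]
      rw [abs_le] at h1 h2
      nlinarith
    rw [eLpNorm_one_eq_lintegral_enorm]
    calc ∫⁻ x, ‖(e n - e m) x‖ₑ ∂ν
        ≤ ∫⁻ x, ENNReal.ofReal (δ / 2 + (e n x - e m x) ^ 2 / (2 * δ)) ∂ν := by
          refine lintegral_mono fun x => ?_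
          rw [Real.enorm_eq_ofReal_abs]
          refine ENNReal.ofReal_le_ofReal ?_
          simp only [Pi.sub_apply]
          have h3 : δ / 2 + (e n x - e m x) ^ 2 / (2 * δ) - |e n x - e m x| =
              (|e n x - e m x| - δ) ^ 2 / (2 * δ) := by
            rw [← sq_abs (e n x - e m x)]
            field_simp
            ring
          have h4 : 0 ≤ (|e n x - e m x| - δ) ^ 2 / (2 * δ) := by positivity
          linarith
      _ = ENNReal.ofReal (∫ x, (δ / 2 + (e n x - e m x) ^ 2 / (2 * δ)) ∂ν) :=
          (ofReal_integral_eq_lintegral_ofReal ((integrable_const _).add (hsq.div_const _))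
            (Eventually.of_forall fun x => by
              change (0 : ℝ) ≤ δ / 2 + (e n x - e m x) ^ 2 / (2 * δ)
              positivity)).symm
      _ ≤ ENNReal.ofReal δ := by
          refine ENNReal.ofReal_le_ofReal ?_
          rw [integral_add (integrable_const _) (hsq.div_const _), integral_div (2 * δ)]
          simp only [integral_const, probReal_univ, one_smul]
          have : (∫ x, (e n x - e m x) ^ 2 ∂ν) / (2 * δ) ≤ δ ^ 2 / (2 * δ) := by gcongr
          have h5 : δ ^ 2 / (2 * δ) = δ / 2 := by field_simp
          linarith
  obtain ⟨φ, hφ, hφc⟩ := extraction_forall_of_eventually'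
    (P := fun k N => ∀ n ≥ N, ∀ m ≥ N, ∫ x, (e n x - e m x) ^ 2 ∂ν ≤ ((1 / 2 : ℝ) ^ k) ^ 2)
    (fun k => by
      obtain ⟨N, hN⟩ := hc (((1 / 2 : ℝ) ^ k) ^ 2) (by positivity)
      exact ⟨N, fun N' h n hn m hm => hN n (h.trans hn) m (h.trans hm)⟩)
  refine ⟨φ, hφ, Lp.ae_tendsto_of_cauchy_eLpNorm (fun k => he (φ k)) le_rfl
    (B := fun k => ENNReal.ofReal (2 * (1 / 2 : ℝ) ^ k)) ?_ fun N n m hn hm => ?_⟩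
  · have hs : Summable fun k : ℕ => 2 * (1 / 2 : ℝ) ^ k := summable_geometric_two.mul_left 2
    rw [← ENNReal.ofReal_tsum_of_nonneg (fun k => by positivity) hs]
    exact ENNReal.ofReal_ne_top
  · refine (key ((1 / 2 : ℝ) ^ N) (by positivity) _ _
      (hφc N _ (hφ.monotone hn) _ (hφ.monotone hm))).trans_lt ?_
    refine (ENNReal.ofReal_lt_ofReal_iff (by positivity)).2 ?_
    have : (0 : ℝ) < (1 / 2) ^ N := by positivity
    linarith

theorem exists_limit_of_exp_tendsto [IsProbabilityMeasure ν] {g : ℕ → X → ℝ} {c : ℝ}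
    (hg : ∀ k, Integrable (g k) ν) (hpos : ∀ k, 0 ≤ᵐ[ν] g k) (hc : ∀ k, ∫ x, g k x ∂ν = c)
    (hl : ∀ᵐ x ∂ν, ∃ l, Tendsto (fun k => Real.exp (-(g k x) / 2)) atTop (𝓝 l)) :
    ∃ h : X → ℝ, Integrable h ν ∧ (∀ᵐ x ∂ν, Tendsto (fun k => g k x) atTop (𝓝 (h x))) ∧
      ∫ x, h x ∂ν ≤ c := by
  have hlin : ∀ k, ∫⁻ x, ENNReal.ofReal (g k x) ∂ν = ENNReal.ofReal c := fun k => by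
    rw [← hc k, ofReal_integral_eq_lintegral_ofReal (hg k) (hpos k)]
  have hc0 : 0 ≤ c := by
    rw [← hc 0]; exact integral_nonneg_of_ae (hpos 0)
  have hm : ∀ k, AEMeasurable (fun x => ENNReal.ofReal (g k x)) ν := fun k =>
    (hg k).aemeasurable.ennreal_ofReal
  have hF : ∫⁻ x, liminf (fun k => ENNReal.ofReal (g k x)) atTop ∂ν ≤ ENNReal.ofReal c := by
    refine (lintegral_liminf_le' hm).trans ?_
    simp [hlin]
  have hfin : ∀ᵐ x ∂ν, liminf (fun k => ENNReal.ofReal (g k x)) atTop < ⊤ :=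
    ae_lt_top' (by
      simp_rw [liminf_eq_iSup_iInf_of_nat]
      exact AEMeasurable.iSup fun n => AEMeasurable.biInf _ (to_countable _) fun i _ => hm i)
    (ne_top_of_le_ne_top ENNReal.ofReal_ne_top hF)
  have hex : ∀ᵐ x ∂ν, ∃ l, Tendsto (fun k => g k x) atTop (𝓝 l) := by
    filter_upwards [hl, hfin] with x ⟨l, hl⟩ hx
    have hl0 : 0 ≤ l := ge_of_tendsto' hl fun k => (Real.exp_pos _).le
    rcases hl0.eq_or_lt with rfl | hlpos
    · exfalso
      have h1 : Tendsto (fun k => Real.exp (-(g k x) / 2)) atTop (𝓝[>] 0) :=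
        tendsto_nhdsWithin_iff.2 ⟨hl, Eventually.of_forall fun k => Real.exp_pos _⟩
      have h2 := Real.tendsto_log_nhdsGT_zero.comp h1
      have h3 : Tendsto (fun k => g k x) atTop atTop := by
        have := h2.const_mul_atBot_of_neg (r := -2) (by norm_num)
        refine this.congr fun k => ?_
        simp only [Function.comp_apply, Real.log_exp]
        ring
      have h4 : Tendsto (fun k => ENNReal.ofReal (g k x)) atTop (𝓝 ⊤) :=
        ENNReal.tendsto_ofReal_atTop.comp h3
      rw [h4.liminf_eq] at hx
      exact lt_irrefl _ hx
    · refine ⟨-2 * Real.log l, ?_⟩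
      have h2 := ((Real.continuousAt_log hlpos.ne').tendsto.comp hl).const_mul (-2)
      refine h2.congr fun k => ?_
      simp only [Function.comp_apply, Real.log_exp]
      ring
  let h : X → ℝ := fun x => limUnder atTop (fun k => g k x)
  have hh : ∀ᵐ x ∂ν, Tendsto (fun k => g k x) atTop (𝓝 (h x)) :=
    hex.mono fun x hx => tendsto_nhds_limUnder hx
  have hmeas : AEStronglyMeasurable h ν :=
    aestronglyMeasurable_of_tendsto_ae atTop (fun k => (hg k).aestronglyMeasurable) hh
  have hh0 : 0 ≤ᵐ[ν] h := by
    filter_upwards [hh, ae_all_iff.2 hpos] with x hx hp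
    exact ge_of_tendsto' hx hp
  have hle : ∫⁻ x, ENNReal.ofReal (h x) ∂ν ≤ ENNReal.ofReal c := by
    refine le_trans (le_of_eq (lintegral_congr_ae ?_)) hF
    filter_upwards [hh] with x hx
    exact ((ENNReal.continuous_ofReal.tendsto _).comp hx).liminf_eq.symm
  have hIv : Integrable h ν := by
    refine ⟨hmeas, ?_⟩
    rw [hasFiniteIntegral_iff_ofReal hh0]
    exact hle.trans_lt ENNReal.ofReal_lt_top
  refine ⟨h, hIv, hh, ?_⟩
  rw [← ofReal_integral_eq_lintegral_ofReal hIv hh0] at hle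
  exact (ENNReal.ofReal_le_ofReal_iff hc0).1 hle

end Limits

/-- Almost minimizers along a decreasing sequence of midpoint-closed sets are almost
midpoint-degenerate. -/
theorem exists_almost_minimizing_seq {P : Type*} {A : ℕ → Set P} (hA : Antitone A)
    (hne : ∀ n, (A n).Nonempty) {L : P → ℝ} (h0 : ∀ p ∈ A 0, 0 ≤ L p) (h1 : ∀ p ∈ A 0, L p ≤ 1)
    {mid : P → P → P} (hmid : ∀ n, ∀ p ∈ A n, ∀ q ∈ A n, mid p q ∈ A n) :
    ∃ p : ℕ → P, (∀ n, p n ∈ A n) ∧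
      ∀ δ > 0, ∃ N, ∀ n ≥ N, ∀ m ≥ N, L (p n) + L (p m) - 2 * L (mid (p n) (p m)) ≤ δ := by
  let s : ℕ → ℝ := fun n => sInf (L '' A n)
  have hbdd : ∀ n, BddBelow (L '' A n) := fun n =>
    ⟨0, by rintro _ ⟨p, hp, rfl⟩; exact h0 p (hA (Nat.zero_le n) hp)⟩
  have hs : ∀ n, ∀ p ∈ A n, s n ≤ L p := fun n p hp => csInf_le (hbdd n) ⟨p, hp, rfl⟩
  have hsm : Monotone s := fun n m hnm =>
    csInf_le_csInf (hbdd n) ((hne m).image L) (image_mono (hA hnm))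
  have hs1 : BddAbove (range s) := by
    refine ⟨1, ?_⟩
    rintro _ ⟨n, rfl⟩
    obtain ⟨p, hp⟩ := hne n
    exact (hs n p hp).trans (h1 p (hA (Nat.zero_le n) hp))
  have hchoose : ∀ n, ∃ p ∈ A n, L p < s n + 1 / ((n : ℝ) + 1) := fun n => by
    obtain ⟨_, ⟨p, hp, rfl⟩, hlt⟩ := exists_lt_of_csInf_lt ((hne n).image L)
      (lt_add_of_pos_right (s n) (Nat.one_div_pos_of_nat (α := ℝ) (n := n)))
    exact ⟨p, hp, hlt⟩
  choose p hp hpL using hchoose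
  refine ⟨p, hp, fun δ hδ => ?_⟩
  have hlim := tendsto_atTop_ciSup hsm hs1
  have e1 : ∀ᶠ n in atTop, (⨆ n, s n) - δ / 4 < s n :=
    hlim.eventually (lt_mem_nhds (by linarith))
  have e2 : ∀ᶠ n : ℕ in atTop, 1 / ((n : ℝ) + 1) < δ / 4 :=
    tendsto_one_div_add_atTop_nhds_zero_nat.eventually (gt_mem_nhds (by linarith))
  obtain ⟨N, hN⟩ := eventually_atTop.1 (e1.and e2)
  refine ⟨N, fun n hn m hm => ?_⟩
  have h3 := hs N _ (hmid N _ (hA hn (hp n)) _ (hA hm (hp m)))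
  have h4 := (hN N le_rfl).1
  have h5 := (hN n hn).2
  have h6 := (hN m hm).2
  have h7 := hpL n
  have h8 := hpL m
  have h9 := le_ciSup hs1 n
  have h10 := le_ciSup hs1 m
  linarith

section Existence
variable {d : ℕ} {α : ℝ} {μ : Measure (Ed d)}

theorem exists_uniform_lower_bound (hα : 0 < α) (hμ : μ ∈ P1 d) :
    ∃ R C : ℝ, 0 ≤ R ∧ ∀ (S : Set (Ed d)) (ψ : Ed d → ℝ), Admissible μ S ψ →
      maxPart α μ / 2 ≤ partFun α S ψ → ∀ y ∈ S, 0 ≤ ψ y + R * ‖y‖ + C := by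
  set D : Ed d → ℝ≥0∞ := fun x => ENNReal.ofReal (domDens α (bary μ) x) with hD
  have hDi : ∫⁻ x, D x ≠ ⊤ := (integrable_domDens hα (bary μ)).lintegral_lt_top.ne
  have hM : 0 < maxPart α μ / 2 := ENNReal.half_pos (maxPart_ne_zero hα hμ)
  obtain ⟨a, ha0, haM⟩ := exists_between hM
  have hε : 0 < a / 2 := ENNReal.half_pos ha0.ne'
  have hεt : a / 2 ≠ ⊤ := by
    have := haM.ne_top
    exact ENNReal.div_ne_top this two_ne_zero
  have : IsFiniteMeasure ((volume : Measure (Ed d)).withDensity D) :=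
    isFiniteMeasure_withDensity hDi
  obtain ⟨K, hK, hKt⟩ := isTightMeasureSet_iff_exists_isCompact_measure_compl_le.1
    (isTightMeasureSet_singleton (μ := (volume : Measure (Ed d)).withDensity D)) (a / 2) hε
  have hKm : MeasurableSet K := hK.measurableSet
  replace hKt := hKt _ rfl
  rw [withDensity_apply _ hKm.compl] at hKt
  obtain ⟨R, hR0, hR⟩ := hK.isBounded.exists_pos_norm_le
  have hKv : volume K ≠ ⊤ := hK.measure_lt_top.ne
  set c : ℝ≥0∞ := a / 2 / (volume K + 1) with hc
  have hc0 : c ≠ 0 := (ENNReal.div_pos hε.ne' (by simp [hKv])).ne'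
  have hct : c ≠ ⊤ := ENNReal.div_ne_top hεt (by simp)
  have hcK : c * volume K ≤ a / 2 := by
    calc c * volume K ≤ c * (volume K + 1) := by gcongr; exact le_self_add
      _ = a / 2 := ENNReal.div_mul_cancel (by simp) (by simp [hKv])
  have hcpos : 0 < c.toReal := ENNReal.toReal_pos hc0 hct
  refine ⟨R, -Real.log c.toReal, hR0.le, fun S ψ h hpart y hy => ?_⟩
  obtain ⟨x, hxK, hx⟩ : ∃ x ∈ K, c < gdens α (supAff S ψ) x := by
    by_contra! hcon
    refine absurd hpart (not_le.2 (lt_of_le_of_lt ?_ haM))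
    rw [partFun, ← lintegral_add_compl _ hKm, ← ENNReal.add_halves a]
    refine add_le_add ?_ ((lintegral_mono fun x => h.gdens_le hμ x).trans hKt)
    refine (setLIntegral_mono' hKm hcon).trans ?_
    simpa using hcK
  have h1 := hx.trans_le (gdens_supAff_le hy x)
  have h2 := ENNReal.toReal_mono ENNReal.ofReal_ne_top h1.le
  rw [ENNReal.toReal_ofReal (Real.exp_pos _).le, ← Real.log_le_iff_le_exp hcpos] at h2
  have h3 : -⟪x, y⟫ ≤ R * ‖y‖ := by
    have := (abs_le.1 (abs_real_inner_le_norm x y)).1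
    have := mul_le_mul_of_nonneg_right (hR x hxK) (norm_nonneg y)
    linarith
  have h4 : 0 ≤ α / 2 * ‖x‖ ^ 2 := by positivity
  linarith

/-- The maximal partition function is attained. -/
theorem exists_maximal_potential (hα : 0 < α) (hμ : μ ∈ P1 d) :
    ∃ (S : Set (Ed d)) (ψ : Ed d → ℝ), Admissible μ S ψ ∧ partFun α S ψ = maxPart α μ := by
  have := hμ.1
  obtain ⟨R, C, hR, hlow⟩ := exists_uniform_lower_bound hα hμ
  have hM0 := maxPart_ne_zero hα hμ
  have hMt := maxPart_ne_top hα hμ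
  obtain ⟨t, htm, htI, htlim⟩ := exists_seq_strictMono_tendsto' (ENNReal.half_lt_self hM0 hMt)
  let A : ℕ → Set (Set (Ed d) × (Ed d → ℝ)) :=
    fun n => {p | Admissible μ p.1 p.2 ∧ t n ≤ partFun α p.1 p.2}
  let g : Set (Ed d) × (Ed d → ℝ) → Ed d → ℝ := fun p y => p.2 y + R * ‖y‖ + C
  let e : Set (Ed d) × (Ed d → ℝ) → Ed d → ℝ := fun p y => Real.exp (-(g p y) / 2)
  let mid : Set (Ed d) × (Ed d → ℝ) → Set (Ed d) × (Ed d → ℝ) → Set (Ed d) × (Ed d → ℝ) :=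
    fun p q => (p.1 ∩ q.1, fun y => (p.2 y + q.2 y) / 2)
  have hA : Antitone A := fun n m hnm p hp => ⟨hp.1, (htm.monotone hnm).trans hp.2⟩
  have hne : ∀ n, (A n).Nonempty := fun n => by
    have h := (htI n).2
    simp only [maxPart, lt_iSup_iff] at h
    obtain ⟨S, ψ, had, h⟩ := h
    exact ⟨(S, ψ), had, h.le⟩
  have hg : ∀ p ∈ A 0, Integrable (g p) μ := fun p hp =>
    (hp.1.integrable.add (hμ.2.const_mul R)).add (integrable_const C)
  have hg0 : ∀ p ∈ A 0, 0 ≤ᵐ[μ] g p := fun p hp =>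
    hp.1.ae_mem.mono fun y hy => hlow p.1 p.2 hp.1 ((htI 0).1.le.trans hp.2) y hy
  have hem : ∀ p ∈ A 0, AEStronglyMeasurable (e p) μ := fun p hp =>
    Real.continuous_exp.comp_aestronglyMeasurable
      ((hg p hp).neg.div_const 2).aestronglyMeasurable
  have heb : ∀ p ∈ A 0, ∀ᵐ y ∂μ, |e p y| ≤ 1 := fun p hp => by
    filter_upwards [hg0 p hp] with y hy
    rw [abs_of_pos (Real.exp_pos _), Real.exp_le_one_iff]
    have : (0 : ℝ) ≤ g p y := hy
    linarith
  have hmid : ∀ n, ∀ p ∈ A n, ∀ q ∈ A n, mid p q ∈ A n := by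
    intro n p hp q hq
    have had := hp.1.midpoint hq.1
    refine ⟨had, ?_⟩
    have h := lintegral_gdens_mul_le (α := α) (ψ₀ := p.2) (ψ₁ := q.2) had.nonempty
      (a := fun _ => 0) (b := fun _ => 0) measurable_const measurable_const
      (fun x y => by simp only [add_zero]; positivity)
    simp only [mul_zero, Real.exp_zero, ENNReal.ofReal_one, mul_one] at h
    by_contra! hcon
    refine absurd h (not_le.2 ((ENNReal.pow_lt_pow_left two_ne_zero hcon).trans_le ?_))
    rw [sq]
    exact mul_le_mul' hp.2 hq.2
  have hmul : ∀ p ∈ A 0, ∀ q ∈ A 0, Integrable (fun y => e p y * e q y) μ := fun p hp q hq => by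
    refine (integrable_const (1 : ℝ)).mono' ((hem p hp).mul (hem q hq)) ?_
    filter_upwards [heb p hp, heb q hq] with y h1 h2
    rw [norm_mul]
    exact mul_le_one₀ h1 (norm_nonneg _) h2
  obtain ⟨p, hpA, hp⟩ := exists_almost_minimizing_seq hA hne
    (L := fun p => ∫ y, e p y * e p y ∂μ) (fun p _ => integral_nonneg fun y => mul_self_nonneg _)
    (fun p hp => by
      calc ∫ y, e p y * e p y ∂μ ≤ ∫ _, (1 : ℝ) ∂μ := by
            refine integral_mono_ae (hmul p hp p hp) (integrable_const _) ?_
            filter_upwards [heb p hp] with y hy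
            rw [← abs_mul_abs_self]
            exact mul_le_one₀ hy (abs_nonneg _) hy
        _ = 1 := by simp) hmid
  have hpA0 : ∀ n, p n ∈ A 0 := fun n => hA (Nat.zero_le n) (hpA n)
  obtain ⟨φ, hφ, hφl⟩ := exists_subseq_ae_tendsto_of_sq_cauchy (ν := μ) (e := fun n => e (p n))
    (fun n => hem _ (hpA0 n)) (fun n => heb _ (hpA0 n)) (fun δ hδ => by
      obtain ⟨N, hN⟩ := hp δ hδ
      refine ⟨N, fun n hn m hm => le_trans (le_of_eq ?_) (hN n hn m hm)⟩
      have e1 : ∀ y, e (mid (p n) (p m)) y * e (mid (p n) (p m)) y = e (p n) y * e (p m) y := by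
        intro y
        simp only [e, g, mid, ← Real.exp_add]
        congr 1
        ring
      simp only [e1]
      have i1 := hmul _ (hpA0 n) _ (hpA0 n)
      have i2 := hmul _ (hpA0 m) _ (hpA0 m)
      have i3 := hmul _ (hpA0 n) _ (hpA0 m)
      have i4 : Integrable (fun y => e (p n) y * e (p n) y + e (p m) y * e (p m) y) μ := i1.add i2
      rw [← integral_const_mul, ← integral_add i1 i2, ← integral_sub i4 (i3.const_mul 2)]
      refine integral_congr_ae (Eventually.of_forall fun y => ?_)
      dsimp only
      ring)
  set q : ℕ → Set (Ed d) × (Ed d → ℝ) := fun k => p (φ k) with hq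
  set c : ℝ := R * ∫ y, ‖y‖ ∂μ + C with hc
  have hgc : ∀ k, ∫ y, g (q k) y ∂μ = c := fun k => by
    have hi := (hpA0 (φ k)).1.integrable
    have hi2 : Integrable (fun y => (p (φ k)).2 y + R * ‖y‖) μ := hi.add (hμ.2.const_mul R)
    change ∫ y, ((p (φ k)).2 y + R * ‖y‖ + C) ∂μ = c
    rw [integral_add hi2 (integrable_const C),
      integral_add hi (hμ.2.const_mul R), integral_const_mul, (hpA0 (φ k)).1.integral_eq]
    simp [hc]
  obtain ⟨h, hhi, hhlim, hhc⟩ := exists_limit_of_exp_tendsto (ν := μ) (g := fun k => g (q k))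
    (fun k => hg _ (hpA0 _)) (fun k => hg0 _ (hpA0 _)) hgc hφl
  set S : Set (Ed d) := {y | (∀ k, y ∈ (q k).1) ∧ Tendsto (fun k => g (q k) y) atTop (𝓝 (h y))}
  set ψ₀ : Ed d → ℝ := fun y => h y - R * ‖y‖ - C with hψ₀
  have hψ₀i : Integrable ψ₀ μ := (hhi.sub (hμ.2.const_mul R)).sub (integrable_const C)
  have hψ₀int : ∫ y, ψ₀ y ∂μ ≤ 0 := by
    have hi2 : Integrable (fun y => h y - R * ‖y‖) μ := hhi.sub (hμ.2.const_mul R)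
    change ∫ y, (h y - R * ‖y‖ - C) ∂μ ≤ 0
    rw [integral_sub hi2 (integrable_const C),
      integral_sub hhi (hμ.2.const_mul R), integral_const_mul]
    simp only [integral_const, probReal_univ, one_smul]
    linarith
  have hS : ∀ᵐ y ∂μ, y ∈ S := by
    filter_upwards [ae_all_iff.2 fun k => (hpA0 (φ k)).1.ae_mem, hhlim] with y h1 h2
    exact ⟨h1, h2⟩
  set m₀ := ∫ y, ψ₀ y ∂μ with hm₀
  have had : Admissible μ S (fun y => ψ₀ y - m₀) :=
    ⟨hS, hψ₀i.sub (integrable_const _), by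
      rw [integral_sub hψ₀i (integrable_const _)]; simp [hm₀]⟩
  refine ⟨S, _, had, le_antisymm had.partFun_le ?_⟩
  have hptw : ∀ x, limsup (fun k => gdens α (supAff (q k).1 (q k).2) x) atTop ≤
      gdens α (supAff S fun y => ψ₀ y - m₀) x := by
    intro x
    refine le_gdens_supAff had.nonempty fun y hy => ?_
    have hlim : Tendsto (fun k => wexp α (q k).2 x y) atTop (𝓝 (wexp α ψ₀ x y)) := by
      have h1 : Tendsto (fun k => (q k).2 y) atTop (𝓝 (ψ₀ y)) := by
        have := (hy.2.sub_const (R * ‖y‖)).sub_const C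
        refine this.congr fun k => ?_
        simp only [g]
        ring
      unfold wexp
      exact (ENNReal.continuous_ofReal.tendsto _).comp ((Real.continuous_exp.tendsto _).comp
        ((h1.sub_const _).sub_const _))
    calc limsup (fun k => gdens α (supAff (q k).1 (q k).2) x) atTop
        ≤ limsup (fun k => wexp α (q k).2 x y) atTop :=
          limsup_le_limsup (Eventually.of_forall fun k => gdens_supAff_le (hy.1 k) x)
      _ = wexp α ψ₀ x y := hlim.limsup_eq
      _ ≤ wexp α (fun y => ψ₀ y - m₀) x y := by
          unfold wexp
          gcongr
          linarith
  have htlim' : Tendsto (fun k => t (φ k)) atTop (𝓝 (maxPart α μ)) :=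
    htlim.comp hφ.tendsto_atTop
  calc maxPart α μ = limsup (fun k => t (φ k)) atTop := htlim'.limsup_eq.symm
    _ ≤ limsup (fun k => partFun α (q k).1 (q k).2) atTop :=
        limsup_le_limsup (Eventually.of_forall fun k => (hpA (φ k)).2)
    _ ≤ ∫⁻ x, limsup (fun k => gdens α (supAff (q k).1 (q k).2) x) atTop :=
        limsup_lintegral_le (fun x => ENNReal.ofReal (domDens α (bary μ) x))
          (fun k => measurable_gdens (measurable_supAff _ _))
          (fun k => Eventually.of_forall fun x => (hpA0 (φ k)).1.gdens_le hμ x)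
          (integrable_domDens hα (bary μ)).lintegral_lt_top.ne
    _ ≤ _ := lintegral_mono hptw

end Existence

section Legendre
variable {d : ℕ} {σ μ : Measure (Ed d)}

theorem lowerSemicontinuous_legendre (u : Ed d → EReal) : LowerSemicontinuous (legendre u) := by
  refine lowerSemicontinuous_iSup fun x => ?_
  have h : ∀ c : EReal, Continuous fun y : Ed d => ((⟪x, y⟫ : ℝ) : EReal) - c := by
    intro c
    induction c with
    | bot => simpa using continuous_const
    | top => simpa using continuous_const
    | coe c =>
      simp only [← EReal.coe_sub]
      exact continuous_coe_real_ereal.comp (by fun_prop)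
  exact (h (u x)).lowerSemicontinuous

theorem le_legendre (u : Ed d → EReal) (x y : Ed d) :
    ((⟪x, y⟫ : ℝ) : EReal) - u x ≤ legendre u y :=
  le_iSup (fun x => ((⟪x, y⟫ : ℝ) : EReal) - u x) x

theorem legendre_supAff_le {S : Set (Ed d)} {ψ : Ed d → ℝ} {y : Ed d} (hy : y ∈ S) :
    legendre (supAff S ψ) y ≤ ψ y := by
  refine iSup_le fun x => ?_
  refine EReal.sub_le_of_le_add ?_
  have h := le_supAff (ψ := ψ) hy x
  calc ((⟪x, y⟫ : ℝ) : EReal) = ((ψ y : ℝ) : EReal) + ((⟪x, y⟫ - ψ y : ℝ) : EReal) := by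
        rw [← EReal.coe_add]; congr 1; ring
    _ ≤ ψ y + supAff S ψ x := by gcongr

/-- If a dual potential is optimal then so is the pair formed by its conjugate and biconjugate. -/
theorem maxCorr_eq_eInt (hσ : σ ∈ P1 d) (hμ : μ ∈ P1 d) {S : Set (Ed d)} {ψ : Ed d → ℝ}
    (hS : ∀ᵐ y ∂μ, y ∈ S) (hψ : Integrable ψ μ) (hfin : ∀ᵐ x ∂σ, supAff S ψ x ≠ ⊤)
    (hU : Integrable (fun x => (supAff S ψ x).toReal) σ)
    (hT : maxCorr σ μ = ((∫ x, (supAff S ψ x).toReal ∂σ + ∫ y, ψ y ∂μ : ℝ) : EReal)) :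
    maxCorr σ μ = eInt σ (supAff S ψ) + eInt μ (legendre (supAff S ψ)) := by
  have := hσ.1
  have := hμ.1
  have hSne : S.Nonempty := hS.exists
  have hbot := supAff_ne_bot hSne ψ
  obtain ⟨x₀, hx₀⟩ := hfin.exists
  set u := supAff S ψ with hu
  set ψ' : Ed d → ℝ := fun y => (legendre u y).toReal with hψ'
  have hlow : ∀ x, u x ≠ ⊤ → ∀ y, ((⟪x, y⟫ - (u x).toReal : ℝ) : EReal) ≤ legendre u y := by
    intro x hx y
    refine le_trans (le_of_eq ?_) (le_legendre u x y)
    rw [EReal.coe_sub, EReal.coe_toReal hx (hbot x)]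
  have hlt : ∀ y ∈ S, legendre u y ≠ ⊤ := fun y hy =>
    ne_top_of_le_ne_top (EReal.coe_ne_top _) (legendre_supAff_le hy)
  have hlb : ∀ y, legendre u y ≠ ⊥ := fun y =>
    ((EReal.bot_lt_coe _).trans_le (hlow x₀ hx₀ y)).ne'
  have hcoe : ∀ y ∈ S, ((ψ' y : ℝ) : EReal) = legendre u y := fun y hy =>
    EReal.coe_toReal (hlt y hy) (hlb y)
  have hle : ∀ y ∈ S, ψ' y ≤ ψ y := fun y hy => by
    have h := legendre_supAff_le (ψ := ψ) hy
    rw [← hu, ← hcoe y hy] at h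
    exact_mod_cast h
  have hge : ∀ x, u x ≠ ⊤ → ∀ y ∈ S, ⟪x, y⟫ - (u x).toReal ≤ ψ' y := fun x hx y hy => by
    have h := hlow x hx y
    rw [← hcoe y hy] at h
    exact_mod_cast h
  have hψ'i : Integrable ψ' μ := by
    refine integrable_of_sandwich
      (lowerSemicontinuous_legendre u).measurable.ereal_toReal.aestronglyMeasurable
      (((integrable_id_of_mem_P1 hμ).const_inner x₀).sub (integrable_const (u x₀).toReal)) hψ ?_ ?_
    · exact hS.mono fun y hy => hge x₀ hx₀ y hy
    · exact hS.mono hle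
  have hu' : supAff S ψ' = u := by
    funext x
    refine le_antisymm (supAff_le fun y hy => ?_) (supAff_le fun y hy => ?_)
    · by_cases hx : u x = ⊤
      · rw [hx]; exact le_top
      · have h := hge x hx y hy
        rw [← EReal.coe_toReal hx (hbot x)]
        exact_mod_cast (by linarith : ⟪x, y⟫ - ψ' y ≤ (u x).toReal)
    · refine le_trans ?_ (le_supAff hy x)
      have h := hle y hy
      exact_mod_cast (by linarith : ⟪x, y⟫ - ψ y ≤ ⟪x, y⟫ - ψ' y)
  have hweak := maxCorr_le (σ := σ) hS hψ'i (by rw [hu']; exact hfin) (by rw [hu']; exact hU)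
  rw [hu', hT] at hweak
  have hle' : ∫ y, ψ' y ∂μ ≤ ∫ y, ψ y ∂μ := integral_mono_ae hψ'i hψ (hS.mono hle)
  have hweak' : ∫ x, (u x).toReal ∂σ + ∫ y, ψ y ∂μ ≤ ∫ x, (u x).toReal ∂σ + ∫ y, ψ' y ∂μ := by
    exact_mod_cast hweak
  rw [hT, eInt_eq_integral hfin (Eventually.of_forall hbot) hU,
    eInt_eq_integral (hS.mono hlt) (Eventually.of_forall hlb) hψ'i, ← EReal.coe_add]
  congr 2
  linarith

end Legendre

section Entropy
variable {d : ℕ} {σ : Measure (Ed d)}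

/-- The density of `σ` with respect to Lebesgue measure, as a real-valued function. -/
def dens (σ : Measure (Ed d)) (x : Ed d) : ℝ := (σ.rnDeriv volume x).toReal

theorem dens_nonneg (σ : Measure (Ed d)) (x : Ed d) : 0 ≤ dens σ x := ENNReal.toReal_nonneg

theorem measurable_dens (σ : Measure (Ed d)) : Measurable (dens σ) :=
  (Measure.measurable_rnDeriv σ volume).ennreal_toReal

theorem integrable_dens_mul_iff [SigmaFinite σ] (hac : σ ≪ volume) {f : Ed d → ℝ} :
    Integrable (fun x => dens σ x * f x) ↔ Integrable f σ :=
  integrable_rnDeriv_smul_iff hac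

theorem integral_dens_mul [SigmaFinite σ] (hac : σ ≪ volume) (f : Ed d → ℝ) :
    ∫ x, dens σ x * f x = ∫ x, f x ∂σ :=
  integral_rnDeriv_smul hac

theorem gibbs_inequality {t r : ℝ} (ht : 0 ≤ t) (hr : 0 < r) :
    0 ≤ t * Real.log t - t * Real.log r - (t - r) := by
  rcases ht.eq_or_lt with rfl | ht
  · simpa using hr.le
  · have h := Real.log_le_sub_one_of_pos (div_pos hr ht)
    rw [Real.log_div hr.ne' ht.ne'] at h
    have h2 := mul_le_mul_of_nonneg_left h ht.le
    have h3 : t * (r / t - 1) = r - t := by field_simp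
    linarith

theorem gibbs_equality {t r : ℝ} (ht : 0 ≤ t) (hr : 0 < r)
    (h : t * Real.log t - t * Real.log r - (t - r) = 0) : t = r := by
  rcases ht.eq_or_lt with rfl | ht
  · simp at h; exact h.symm
  · by_contra hne
    have h1 : r / t ≠ 1 := fun h1 => hne ((div_eq_one_iff_eq ht.ne').1 h1).symm
    have h := Real.log_lt_sub_one_of_pos (div_pos hr ht) h1
    rw [Real.log_div hr.ne' ht.ne'] at h
    have h2 := mul_lt_mul_of_pos_left h ht
    have h3 : t * (r / t - 1) = r - t := by field_simp
    linarith

theorem Ent_of_not_ac (h : ¬ σ ≪ volume) : Ent σ = ⊤ := by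
  simp [Ent, h]

theorem Ent_of_ac (h : σ ≪ volume) :
    Ent σ = sInt volume (fun x => dens σ x * Real.log (dens σ x)) := by
  simp [Ent, h, dens]

theorem entropy_lower_bound (hσ : σ ∈ P1 d) (hac : σ ≪ volume) :
    ∃ l : Ed d → ℝ, Integrable l ∧ ∀ x, l x ≤ dens σ x * Real.log (dens σ x) := by
  have := hσ.1
  refine ⟨fun x => -(dens σ x * (((d : ℝ) + 1) * ‖x‖)) - (1 + ‖x‖) ^ (-((d : ℝ) + 1)), ?_, ?_⟩
  · refine ((integrable_dens_mul_iff hac).2 (hσ.2.const_mul _)).neg.sub ?_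
    refine integrable_one_add_norm ?_
    simp
  · intro x
    have hpos : 0 < 1 + ‖x‖ := by positivity
    have h := gibbs_inequality (dens_nonneg σ x) (Real.rpow_pos_of_pos hpos (-((d : ℝ) + 1)))
    rw [Real.log_rpow hpos] at h
    have h1 : Real.log (1 + ‖x‖) ≤ ‖x‖ := by
      have := Real.log_le_sub_one_of_pos hpos
      linarith
    have h2 : dens σ x * (((d : ℝ) + 1) * Real.log (1 + ‖x‖)) ≤
        dens σ x * (((d : ℝ) + 1) * ‖x‖) := by
      have := dens_nonneg σ x
      gcongr
    have h3 := dens_nonneg σ x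
    linarith

theorem Ent_ne_bot (hσ : σ ∈ P1 d) : Ent σ ≠ ⊥ := by
  by_cases hac : σ ≪ volume
  · obtain ⟨l, hl, hle⟩ := entropy_lower_bound hσ hac
    rw [Ent_of_ac hac]
    exact sInt_ne_bot hl (Eventually.of_forall hle)
  · rw [Ent_of_not_ac hac]; simp

theorem integrable_entropy (hσ : σ ∈ P1 d) (h : Ent σ ≠ ⊤) :
    σ ≪ volume ∧ Integrable (fun x => dens σ x * Real.log (dens σ x)) := by
  by_cases hac : σ ≪ volume
  · obtain ⟨l, hl, hle⟩ := entropy_lower_bound hσ hac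
    rw [Ent_of_ac hac] at h
    refine ⟨hac, integrable_of_sInt_ne_top ?_ hl (Eventually.of_forall hle) h⟩
    exact ((measurable_dens σ).mul (measurable_dens σ).log).aestronglyMeasurable
  · exact absurd (Ent_of_not_ac hac) h

theorem coe_mul_M2e {α : ℝ} (h : Integrable (fun x => ‖x‖ ^ 2) σ) :
    ((α / 2 : ℝ) : EReal) * ((M2e σ : ℝ≥0∞) : EReal) =
      ((α / 2 * ∫ x, ‖x‖ ^ 2 ∂σ : ℝ) : EReal) := by
  have e : M2e σ = ENNReal.ofReal (∫ x, ‖x‖ ^ 2 ∂σ) :=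
    (ofReal_integral_eq_lintegral_ofReal h (Eventually.of_forall fun x => sq_nonneg _)).symm
  rw [e, EReal.coe_ennreal_ofReal, max_eq_left (integral_nonneg fun x => sq_nonneg _),
    ← EReal.coe_mul]

theorem integrable_sq_of_M2e_ne_top (h : M2e σ ≠ ⊤) : Integrable (fun x => ‖x‖ ^ 2) σ := by
  refine ⟨by fun_prop, ?_⟩
  rw [hasFiniteIntegral_iff_ofReal (Eventually.of_forall fun x => sq_nonneg _)]
  exact h.lt_top

end Entropy

section Gibbs
variable {d : ℕ} {α : ℝ} {σ μ : Measure (Ed d)} {S : Set (Ed d)} {ψ : Ed d → ℝ}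

theorem supAff_sub_const (S : Set (Ed d)) (ψ : Ed d → ℝ) (m : ℝ) (x : Ed d) :
    supAff S (fun y => ψ y - m) x = supAff S ψ x + m := by
  refine le_antisymm (supAff_le fun y hy => ?_) ?_
  · have e : ((⟪x, y⟫ - (ψ y - m) : ℝ) : EReal) = ((⟪x, y⟫ - ψ y : ℝ) : EReal) + m := by
      rw [← EReal.coe_add]; congr 1; ring
    rw [e]
    gcongr
    exact le_supAff hy x
  · refine EReal.add_le_of_le_sub (supAff_le fun y hy => ?_)
    refine (EReal.le_sub_iff_add_le (by simp) (by simp)).2 ?_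
    refine le_trans (le_of_eq ?_) (le_supAff hy x)
    rw [← EReal.coe_add]; congr 1; ring

theorem exists_admissible_dual (hσ : σ ∈ P1 d) (hμ : μ ∈ P1 d) (hT : maxCorr σ μ ≠ ⊤) :
    ∃ (S : Set (Ed d)) (ψ : Ed d → ℝ), Admissible μ S ψ ∧
      (∀ᵐ x ∂σ, supAff S ψ x ≠ ⊤) ∧ Integrable (fun x => (supAff S ψ x).toReal) σ ∧
      maxCorr σ μ = ((∫ x, (supAff S ψ x).toReal ∂σ : ℝ) : EReal) := by
  have := hσ.1
  have := hμ.1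
  obtain ⟨S, ψ, hS, hψ, hfin, hU, hT⟩ := exists_dual_potential hσ hμ hT
  have hSne : S.Nonempty := hS.exists
  set m := ∫ y, ψ y ∂μ
  have hadm : Admissible μ S (fun y => ψ y - m) :=
    ⟨hS, hψ.sub (integrable_const _), by rw [integral_sub hψ (integrable_const _)]; simp [m]⟩
  have hae : ∀ᵐ x ∂σ, (supAff S ψ x).toReal + m = (supAff S (fun y => ψ y - m) x).toReal := by
    filter_upwards [hfin] with x hx
    rw [supAff_sub_const, EReal.toReal_add hx (supAff_ne_bot hSne ψ x) (by simp) (by simp),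
      EReal.toReal_coe]
  refine ⟨S, fun y => ψ y - m, hadm, ?_, (hU.add (integrable_const m)).congr hae, ?_⟩
  · filter_upwards [hfin] with x hx
    rw [supAff_sub_const]
    exact (EReal.add_lt_top hx (by simp)).ne
  · rw [hT, ← integral_congr_ae hae, integral_add hU (integrable_const m)]
    simp

/-- The normalized Gibbs measure of a potential. -/
def gibbs (α : ℝ) (S : Set (Ed d)) (ψ : Ed d → ℝ) : Measure (Ed d) :=
  volume.withDensity fun x =>
    ENNReal.ofReal (1 / (partFun α S ψ).toReal) * gdens α (supAff S ψ) x

theorem gdens_ne_top (u : Ed d → EReal) (x : Ed d) : gdens α u x ≠ ⊤ := by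
  unfold gdens
  split_ifs <;> simp

theorem gdens_toReal {u : Ed d → EReal} {x : Ed d} (h : u x ≠ ⊤) :
    (gdens α u x).toReal = Real.exp (-(u x).toReal - (α / 2) * ‖x‖ ^ 2) := by
  rw [gdens, if_neg h, ENNReal.toReal_ofReal (Real.exp_pos _).le]

theorem gdens_toReal_of_eq_top {u : Ed d → EReal} {x : Ed d} (h : u x = ⊤) :
    (gdens α u x).toReal = 0 := by
  simp [gdens, h]

theorem Admissible.partFun_ne_top (hα : 0 < α) (hμ : μ ∈ P1 d) (h : Admissible μ S ψ) :
    partFun α S ψ ≠ ⊤ :=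
  ne_top_of_le_ne_top (maxPart_ne_top hα hμ) h.partFun_le

/-- The real-valued Gibbs density. -/
def gibbsDens (α : ℝ) (S : Set (Ed d)) (ψ : Ed d → ℝ) (x : Ed d) : ℝ :=
  (gdens α (supAff S ψ) x).toReal / (partFun α S ψ).toReal

theorem measurable_gibbsDens : Measurable (gibbsDens α S ψ) :=
  (measurable_gdens (measurable_supAff S ψ)).ennreal_toReal.div_const _

theorem gibbsDens_nonneg (x : Ed d) : 0 ≤ gibbsDens α S ψ x := by
  unfold gibbsDens; positivity

theorem gibbs_eq :
    gibbs α S ψ = volume.withDensity fun x => ENNReal.ofReal (gibbsDens α S ψ x) := by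
  unfold gibbs gibbsDens
  congr 1
  funext x
  rw [one_div, div_eq_inv_mul, ENNReal.ofReal_mul (by positivity),
    ENNReal.ofReal_toReal (gdens_ne_top _ _)]

theorem lintegral_gibbsDens (h0 : partFun α S ψ ≠ 0) (htop : partFun α S ψ ≠ ⊤) :
    ∫⁻ x, ENNReal.ofReal (gibbsDens α S ψ x) = 1 := by
  have e : ∀ x, ENNReal.ofReal (gibbsDens α S ψ x) =
      (partFun α S ψ)⁻¹ * gdens α (supAff S ψ) x := fun x => by
    rw [gibbsDens, ENNReal.ofReal_div_of_pos (ENNReal.toReal_pos h0 htop),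
      ENNReal.ofReal_toReal (gdens_ne_top _ _), ENNReal.ofReal_toReal htop, ENNReal.div_eq_inv_mul]
  simp_rw [e]
  rw [lintegral_const_mul _ (measurable_gdens (measurable_supAff S ψ)), ← partFun,
    ENNReal.inv_mul_cancel h0 htop]

theorem integrable_gibbsDens (h0 : partFun α S ψ ≠ 0) (htop : partFun α S ψ ≠ ⊤) :
    Integrable (gibbsDens α S ψ) := by
  refine ⟨measurable_gibbsDens.aestronglyMeasurable, ?_⟩
  rw [hasFiniteIntegral_iff_ofReal (Eventually.of_forall gibbsDens_nonneg),
    lintegral_gibbsDens h0 htop]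
  exact one_lt_top

theorem integral_gibbsDens (h0 : partFun α S ψ ≠ 0) (htop : partFun α S ψ ≠ ⊤) :
    ∫ x, gibbsDens α S ψ x = 1 := by
  rw [integral_eq_lintegral_of_nonneg_ae (Eventually.of_forall gibbsDens_nonneg)
    measurable_gibbsDens.aestronglyMeasurable, lintegral_gibbsDens h0 htop]
  rfl

theorem isProbabilityMeasure_gibbs (h0 : partFun α S ψ ≠ 0) (htop : partFun α S ψ ≠ ⊤) :
    IsProbabilityMeasure (gibbs α S ψ) := by
  rw [gibbs_eq]
  refine ⟨?_⟩
  rw [withDensity_apply _ MeasurableSet.univ, Measure.restrict_univ, lintegral_gibbsDens h0 htop]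

theorem gibbsDens_pos (h0 : partFun α S ψ ≠ 0) (htop : partFun α S ψ ≠ ⊤) {x : Ed d}
    (hx : supAff S ψ x ≠ ⊤) : 0 < gibbsDens α S ψ x := by
  rw [gibbsDens, gdens_toReal hx]
  exact div_pos (Real.exp_pos _) (ENNReal.toReal_pos h0 htop)

theorem log_gibbsDens (h0 : partFun α S ψ ≠ 0) (htop : partFun α S ψ ≠ ⊤) {x : Ed d}
    (hx : supAff S ψ x ≠ ⊤) : Real.log (gibbsDens α S ψ x) =
      -(supAff S ψ x).toReal - (α / 2) * ‖x‖ ^ 2 - Real.log (partFun α S ψ).toReal := by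
  rw [gibbsDens, gdens_toReal hx, Real.log_div (Real.exp_pos _).ne'
    (ENNReal.toReal_pos h0 htop).ne', Real.log_exp]

theorem withDensity_dens [SigmaFinite σ] (hac : σ ≪ volume) :
    (volume.withDensity fun x => ENNReal.ofReal (dens σ x)) = σ := by
  conv_rhs => rw [← Measure.withDensity_rnDeriv_eq σ volume hac]
  refine withDensity_congr_ae ?_
  filter_upwards [Measure.rnDeriv_ne_top σ volume] with x hx
  exact ENNReal.ofReal_toReal hx

theorem ae_dens_eq_zero_or [SigmaFinite σ] (hac : σ ≪ volume) {p : Ed d → Prop}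
    (h : ∀ᵐ x ∂σ, p x) : ∀ᵐ x, dens σ x ≠ 0 → p x := by
  rw [← withDensity_dens hac, ae_withDensity_iff (measurable_dens σ).ennreal_ofReal] at h
  filter_upwards [h] with x hx hd
  refine hx ?_
  simpa using (dens_nonneg σ x).lt_of_ne' hd

theorem partFun_ne_zero (hσ : σ ∈ P1 d) (hac : σ ≪ volume)
    (hfin : ∀ᵐ x ∂σ, supAff S ψ x ≠ ⊤) : partFun α S ψ ≠ 0 := by
  have := hσ.1
  intro h0
  rw [partFun, lintegral_eq_zero_iff (measurable_gdens (measurable_supAff S ψ))] at h0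
  have h1 : ∀ᵐ x ∂σ, False := by
    filter_upwards [hac.ae_le h0, hfin] with x h hx
    rw [Pi.zero_apply, gdens, if_neg hx, ENNReal.ofReal_eq_zero] at h
    exact absurd (Real.exp_pos _) (not_lt.2 h)
  simpa using h1.exists

/-- Up to a constant, the functional at `σ` is the relative entropy of `σ` with respect to the
Gibbs measure of an optimal dual potential. -/
theorem Ffun_eq_relativeEntropy (hα : 0 < α) (hσ : σ ∈ P1 d) (hμ : μ ∈ P1 d)
    (hadm : Admissible μ S ψ) (hfin : ∀ᵐ x ∂σ, supAff S ψ x ≠ ⊤)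
    (hU : Integrable (fun x => (supAff S ψ x).toReal) σ)
    (hT : maxCorr σ μ = ((∫ x, (supAff S ψ x).toReal ∂σ : ℝ) : EReal))
    (hE : Ent σ ≠ ⊤) (hM : M2e σ ≠ ⊤) :
    partFun α S ψ ≠ 0 ∧ ∃ c : ℝ, 0 ≤ c ∧
      Ffun α μ σ = ((c - Real.log (partFun α S ψ).toReal : ℝ) : EReal) ∧
      (c = 0 → σ = gibbs α S ψ) := by
  have := hσ.1
  obtain ⟨hac, hEi⟩ := integrable_entropy hσ hE
  have hMi := integrable_sq_of_M2e_ne_top hM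
  have h0 : partFun α S ψ ≠ 0 := partFun_ne_zero hσ hac hfin
  have htop := hadm.partFun_ne_top hα hμ
  refine ⟨h0, ?_⟩
  set L := Real.log (partFun α S ψ).toReal with hL
  set V : Ed d → ℝ := fun x => (supAff S ψ x).toReal + (α / 2) * ‖x‖ ^ 2 + (L - 1) with hV
  have hVi : Integrable V σ := (hU.add (hMi.const_mul (α / 2))).add (integrable_const (L - 1))
  have hsV : Integrable (fun x => dens σ x * V x) := (integrable_dens_mul_iff hac).2 hVi
  have hri := integrable_gibbsDens h0 htop
  set D : Ed d → ℝ := fun x => dens σ x * Real.log (dens σ x) + dens σ x * V x + gibbsDens α S ψ x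
    with hD
  have hDi : Integrable D := (hEi.add hsV).add hri
  have hfin' := ae_dens_eq_zero_or hac hfin
  have hDeq : ∀ x, supAff S ψ x ≠ ⊤ → D x = dens σ x * Real.log (dens σ x) -
      dens σ x * Real.log (gibbsDens α S ψ x) - (dens σ x - gibbsDens α S ψ x) := by
    intro x hx
    rw [log_gibbsDens h0 htop hx]
    simp only [hD, hV]
    ring
  have hD0 : 0 ≤ᵐ[volume] D := by
    filter_upwards [hfin'] with x hx
    by_cases hu : supAff S ψ x = ⊤
    · have hz : dens σ x = 0 := by
        by_contra hne
        exact hx hne hu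
      simpa [hD, hz] using gibbsDens_nonneg x
    · rw [Pi.zero_apply, hDeq x hu]
      exact gibbs_inequality (dens_nonneg σ x) (gibbsDens_pos h0 htop hu)
  have hIv : ∫ x, V x ∂σ =
      ∫ x, (supAff S ψ x).toReal ∂σ + α / 2 * ∫ x, ‖x‖ ^ 2 ∂σ + (L - 1) := by
    have h1 : Integrable (fun x => (supAff S ψ x).toReal + (α / 2) * ‖x‖ ^ 2) σ :=
      hU.add (hMi.const_mul (α / 2))
    rw [hV, integral_add h1 (integrable_const _), integral_add hU (hMi.const_mul _),
      integral_const_mul]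
    simp
  have hDint : ∫ x, D x = (∫ x, dens σ x * Real.log (dens σ x)) + ∫ x, V x ∂σ + 1 := by
    have h1 : Integrable (fun x => dens σ x * Real.log (dens σ x) + dens σ x * V x) := hEi.add hsV
    rw [hD, integral_add h1 hri, integral_add hEi hsV, integral_gibbsDens h0 htop,
      integral_dens_mul hac V]
  refine ⟨∫ x, D x, integral_nonneg_of_ae hD0, ?_, fun hz => ?_⟩
  · rw [Ffun, hT, coe_mul_M2e hMi, Ent_of_ac hac, sInt_eq_integral hEi, ← EReal.coe_add,
      ← EReal.coe_add, hDint, hIv]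
    congr 1
    ring
  · rw [integral_eq_zero_iff_of_nonneg_ae hD0 hDi] at hz
    rw [gibbs_eq, ← withDensity_dens hac]
    refine withDensity_congr_ae ?_
    filter_upwards [hz, hfin'] with x hx hf
    congr 1
    by_cases hu : supAff S ψ x = ⊤
    · have hz : dens σ x = 0 := by
        by_contra hne
        exact hf hne hu
      rw [hz, gibbsDens, gdens_toReal_of_eq_top hu, zero_div]
    · rw [Pi.zero_apply, hDeq x hu] at hx
      exact gibbs_equality (dens_nonneg σ x) (gibbsDens_pos h0 htop hu) hx

theorem ne_top_of_Ffun_ne_top (hα : 0 < α) (hσ : σ ∈ P1 d) (hμ : μ ∈ P1 d) (h : Ffun α μ σ ≠ ⊤) :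
    Ent σ ≠ ⊤ ∧ maxCorr σ μ ≠ ⊤ ∧ M2e σ ≠ ⊤ := by
  have h1 := Ent_ne_bot hσ
  have h2 := maxCorr_ne_bot hσ hμ
  have h12 : Ent σ + maxCorr σ μ ≠ ⊥ := by simp [EReal.add_eq_bot_iff, h1, h2]
  have h3 : ((α / 2 : ℝ) : EReal) * ((M2e σ : ℝ≥0∞) : EReal) ≠ ⊥ :=
    (EReal.bot_lt_zero.trans_le (mul_nonneg (by exact_mod_cast (half_pos hα).le)
      (EReal.coe_ennreal_nonneg _))).ne'
  refine ⟨fun e => h ?_, fun e => h ?_, fun e => h ?_⟩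
  · rw [Ffun, e, EReal.top_add_of_ne_bot h2, EReal.top_add_of_ne_bot h3]
  · rw [Ffun, e, EReal.add_top_of_ne_bot h1, EReal.top_add_of_ne_bot h3]
  · rw [Ffun, e, EReal.coe_ennreal_top, EReal.coe_mul_top_of_pos (half_pos hα),
      EReal.add_top_of_ne_bot h12]

end Gibbs

section GibbsMeasure
variable {d : ℕ} {α : ℝ} {σ μ : Measure (Ed d)} {S : Set (Ed d)} {ψ : Ed d → ℝ}

theorem integrable_sq_mul_domDens (hα : 0 < α) (b : Ed d) :
    Integrable (fun x => domDens α b x * ‖x‖ ^ 2) := by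
  refine ((integrable_domDens (half_pos hα) b).const_mul (4 / α)).mono'
    (by unfold domDens; fun_prop) (Eventually.of_forall fun x => ?_)
  have e : domDens α b x = domDens (α / 2) b x * Real.exp (-(α / 4 * ‖x‖ ^ 2)) := by
    rw [domDens, domDens, ← Real.exp_add]; congr 1; ring
  have h1 : α / 4 * ‖x‖ ^ 2 * Real.exp (-(α / 4 * ‖x‖ ^ 2)) ≤ 1 := by
    rw [Real.exp_neg, ← div_eq_mul_inv, div_le_one (Real.exp_pos _)]
    linarith [Real.add_one_le_exp (α / 4 * ‖x‖ ^ 2)]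
  have h2 : 0 < domDens (α / 2) b x := Real.exp_pos _
  rw [Real.norm_of_nonneg (by unfold domDens; positivity), e]
  have e2 : domDens (α / 2) b x * Real.exp (-(α / 4 * ‖x‖ ^ 2)) * ‖x‖ ^ 2 =
      4 / α * domDens (α / 2) b x * (α / 4 * ‖x‖ ^ 2 * Real.exp (-(α / 4 * ‖x‖ ^ 2))) := by
    field_simp
  rw [e2]
  exact mul_le_of_le_one_right (by positivity) h1

theorem gibbs_ac : gibbs α S ψ ≪ volume := withDensity_absolutelyContinuous _ _

theorem dens_gibbs : dens (gibbs α S ψ) =ᵐ[volume] gibbsDens α S ψ := by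
  have h := Measure.rnDeriv_withDensity (volume : Measure (Ed d))
    (measurable_gibbsDens (α := α) (S := S) (ψ := ψ)).ennreal_ofReal
  filter_upwards [h] with x hx
  rw [dens, gibbs_eq, hx, ENNReal.toReal_ofReal (gibbsDens_nonneg x)]

theorem integrable_gibbs_iff [SigmaFinite (gibbs α S ψ)] {f : Ed d → ℝ} :
    Integrable f (gibbs α S ψ) ↔ Integrable (fun x => gibbsDens α S ψ x * f x) := by
  rw [← integrable_dens_mul_iff gibbs_ac]
  refine integrable_congr ?_
  filter_upwards [dens_gibbs (α := α) (S := S) (ψ := ψ)] with x hx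
  rw [hx]

theorem integral_gibbs [SigmaFinite (gibbs α S ψ)] (f : Ed d → ℝ) :
    ∫ x, f x ∂(gibbs α S ψ) = ∫ x, gibbsDens α S ψ x * f x := by
  rw [← integral_dens_mul gibbs_ac]
  refine integral_congr_ae ?_
  filter_upwards [dens_gibbs (α := α) (S := S) (ψ := ψ)] with x hx
  rw [hx]

theorem Admissible.gibbsDens_le (hμ : μ ∈ P1 d) (h : Admissible μ S ψ) (x : Ed d) :
    gibbsDens α S ψ x ≤ (partFun α S ψ).toReal⁻¹ * domDens α (bary μ) x := by
  have h1 := ENNReal.toReal_mono ENNReal.ofReal_ne_top (h.gdens_le (α := α) hμ x)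
  rw [ENNReal.toReal_ofReal (show 0 ≤ domDens α (bary μ) x from (Real.exp_pos _).le)] at h1
  rw [gibbsDens, div_eq_inv_mul]
  gcongr

theorem Admissible.integrable_sq_gibbs (hα : 0 < α) (hμ : μ ∈ P1 d) (h : Admissible μ S ψ)
    (h0 : partFun α S ψ ≠ 0) : Integrable (fun x => ‖x‖ ^ 2) (gibbs α S ψ) := by
  have := isProbabilityMeasure_gibbs h0 (h.partFun_ne_top hα hμ)
  rw [integrable_gibbs_iff]
  refine ((integrable_sq_mul_domDens hα (bary μ)).const_mul (partFun α S ψ).toReal⁻¹).mono'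
    (measurable_gibbsDens.aestronglyMeasurable.mul (by fun_prop)) (Eventually.of_forall fun x => ?_)
  have h1 := h.gibbsDens_le (α := α) hμ x
  rw [Real.norm_of_nonneg (mul_nonneg (gibbsDens_nonneg x) (sq_nonneg _)), ← mul_assoc]
  gcongr

theorem Admissible.gibbs_mem_P1 (hα : 0 < α) (hμ : μ ∈ P1 d) (h : Admissible μ S ψ)
    (h0 : partFun α S ψ ≠ 0) : gibbs α S ψ ∈ P1 d := by
  have hp := isProbabilityMeasure_gibbs h0 (h.partFun_ne_top hα hμ)
  refine ⟨hp, ((integrable_const (1 : ℝ)).add (h.integrable_sq_gibbs hα hμ h0)).mono'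
    (by fun_prop) (Eventually.of_forall fun x => ?_)⟩
  simp only [norm_norm, Pi.add_apply]
  nlinarith [sq_nonneg (‖x‖ - 1), norm_nonneg x]

theorem ae_gibbs_ne_top : ∀ᵐ x ∂(gibbs α S ψ), supAff S ψ x ≠ ⊤ := by
  rw [gibbs_eq, ae_withDensity_iff measurable_gibbsDens.ennreal_ofReal]
  refine Eventually.of_forall fun x hx hu => hx ?_
  rw [gibbsDens, gdens_toReal_of_eq_top hu]
  simp

theorem Admissible.integrable_supAff_gibbs (hα : 0 < α) (hμ : μ ∈ P1 d) (h : Admissible μ S ψ)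
    (h0 : partFun α S ψ ≠ 0) : Integrable (fun x => (supAff S ψ x).toReal) (gibbs α S ψ) := by
  have := isProbabilityMeasure_gibbs h0 (h.partFun_ne_top hα hμ)
  set k := (partFun α S ψ).toReal
  have hx1 := (h.gibbs_mem_P1 hα hμ h0).2.const_mul ‖bary μ‖
  rw [integrable_gibbs_iff] at hx1 ⊢
  refine (((integrable_domDens hα 0).const_mul k⁻¹).add hx1).mono'
    (measurable_gibbsDens.mul (measurable_supAff S ψ).ereal_toReal).aestronglyMeasurable
    (Eventually.of_forall fun x => ?_)
  have hg := gibbsDens_nonneg (α := α) (S := S) (ψ := ψ) x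
  have hD : 0 < domDens α (0 : Ed d) x := Real.exp_pos _
  have hk : 0 ≤ k := ENNReal.toReal_nonneg
  simp only [Pi.add_apply]
  by_cases hu : supAff S ψ x = ⊤
  · rw [gibbsDens, gdens_toReal_of_eq_top hu]
    simp only [zero_div, zero_mul, norm_zero, add_zero]
    positivity
  · rw [norm_mul, Real.norm_of_nonneg hg, Real.norm_eq_abs]
    have h1 := h.inner_bary_le hμ hu
    set U := (supAff S ψ x).toReal with hU
    rcases le_total 0 U with hU0 | hU0
    · have h2 : U * Real.exp (-U) ≤ 1 := by
        rw [Real.exp_neg, ← div_eq_mul_inv, div_le_one (Real.exp_pos _)]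
        linarith [Real.add_one_le_exp U]
      have h3 : gibbsDens α S ψ x * U = k⁻¹ * (domDens α 0 x * (U * Real.exp (-U))) := by
        rw [gibbsDens, gdens_toReal hu, domDens, sub_eq_add_neg, Real.exp_add, inner_zero_right]
        simp only [neg_zero, zero_sub, ← hU, div_eq_inv_mul]
        ring
      rw [abs_of_nonneg hU0, h3]
      refine le_add_of_le_of_nonneg ?_ (by positivity)
      gcongr
      exact mul_le_of_le_one_right hD.le h2
    · refine le_add_of_nonneg_of_le (by positivity) ?_
      gcongr
      rw [abs_of_nonpos hU0]
      have h2 := (abs_le.1 (abs_real_inner_le_norm x (bary μ))).1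
      linarith

theorem Admissible.Ffun_gibbs_le (hα : 0 < α) (hμ : μ ∈ P1 d) (h : Admissible μ S ψ)
    (h0 : partFun α S ψ ≠ 0) :
    Ffun α μ (gibbs α S ψ) ≤ ((-Real.log (partFun α S ψ).toReal : ℝ) : EReal) := by
  have htop := h.partFun_ne_top hα hμ
  have := isProbabilityMeasure_gibbs h0 htop
  have hM := h.integrable_sq_gibbs hα hμ h0
  have hU := h.integrable_supAff_gibbs hα hμ h0
  set L := Real.log (partFun α S ψ).toReal with hL
  set V : Ed d → ℝ := fun x => -((supAff S ψ x).toReal + (α / 2) * ‖x‖ ^ 2 + L) with hV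
  have hUM : Integrable (fun x => (supAff S ψ x).toReal + (α / 2) * ‖x‖ ^ 2) (gibbs α S ψ) :=
    hU.add (hM.const_mul (α / 2))
  have hVi : Integrable V (gibbs α S ψ) := (hUM.add (integrable_const L)).neg
  have hE : (fun x => dens (gibbs α S ψ) x * Real.log (dens (gibbs α S ψ) x)) =ᵐ[volume]
      fun x => gibbsDens α S ψ x * V x := by
    filter_upwards [dens_gibbs (α := α) (S := S) (ψ := ψ)] with x hx
    rw [hx]
    by_cases hu : supAff S ψ x = ⊤
    · rw [gibbsDens, gdens_toReal_of_eq_top hu]; simp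
    · rw [log_gibbsDens h0 htop hu, hV]
      ring
  have hT := maxCorr_le h.ae_mem h.integrable ae_gibbs_ne_top hU
  rw [h.integral_eq, add_zero] at hT
  have hIv : ∫ x, V x ∂(gibbs α S ψ) = -(∫ x, (supAff S ψ x).toReal ∂(gibbs α S ψ) +
      α / 2 * ∫ x, ‖x‖ ^ 2 ∂(gibbs α S ψ) + L) := by
    rw [hV, integral_neg, integral_add hUM (integrable_const _),
      integral_add hU (hM.const_mul _), integral_const_mul]
    simp
  rw [Ffun, coe_mul_M2e hM, Ent_of_ac gibbs_ac, sInt_congr_ae hE,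
    sInt_eq_integral (integrable_gibbs_iff.1 hVi), ← integral_gibbs, hIv]
  calc _ ≤ ((-(∫ x, (supAff S ψ x).toReal ∂(gibbs α S ψ) +
      α / 2 * ∫ x, ‖x‖ ^ 2 ∂(gibbs α S ψ) + L) : ℝ) : EReal) +
        ((∫ x, (supAff S ψ x).toReal ∂(gibbs α S ψ) : ℝ) : EReal) +
        ((α / 2 * ∫ x, ‖x‖ ^ 2 ∂(gibbs α S ψ) : ℝ) : EReal) := by gcongr
    _ = _ := by
      rw [← EReal.coe_add, ← EReal.coe_add]
      congr 1
      ring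

theorem exists_isMinOfF (hα : 0 < α) (hμ : μ ∈ P1 d) :
    (∃ ρ, IsMinOfF α μ ρ) ∧ ∀ ρ, IsMinOfF α μ ρ → ∃ (S : Set (Ed d)) (ψ : Ed d → ℝ),
      Admissible μ S ψ ∧ partFun α S ψ = maxPart α μ ∧ ρ = gibbs α S ψ ∧
      maxCorr ρ μ = eInt ρ (supAff S ψ) + eInt μ (legendre (supAff S ψ)) := by
  have hM0 := maxPart_ne_zero hα hμ
  have hMt := maxPart_ne_top hα hμ
  set M := (maxPart α μ).toReal with hM
  have key : ∀ σ ∈ P1 d, Ffun α μ σ ≠ ⊤ → ∃ (S : Set (Ed d)) (ψ : Ed d → ℝ),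
      Admissible μ S ψ ∧ partFun α S ψ ≠ 0 ∧
      maxCorr σ μ = eInt σ (supAff S ψ) + eInt μ (legendre (supAff S ψ)) ∧
      ∃ c : ℝ, 0 ≤ c ∧ Ffun α μ σ = ((c - Real.log (partFun α S ψ).toReal : ℝ) : EReal) ∧
        (c = 0 → σ = gibbs α S ψ) := by
    intro σ hσ hF
    obtain ⟨hE, hT, h2⟩ := ne_top_of_Ffun_ne_top hα hσ hμ hF
    obtain ⟨S, ψ, hadm, hfin, hU, hT⟩ := exists_admissible_dual hσ hμ hT
    obtain ⟨h0, hc⟩ := Ffun_eq_relativeEntropy hα hσ hμ hadm hfin hU hT hE h2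
    refine ⟨S, ψ, hadm, h0, ?_, hc⟩
    refine maxCorr_eq_eInt hσ hμ hadm.ae_mem hadm.integrable hfin hU ?_
    rw [hT, hadm.integral_eq, add_zero]
  have hlog : ∀ {S ψ}, Admissible μ S ψ → partFun α S ψ ≠ 0 →
      Real.log (partFun α S ψ).toReal ≤ Real.log M := fun h h0 =>
    Real.log_le_log (ENNReal.toReal_pos h0 (h.partFun_ne_top hα hμ))
      (ENNReal.toReal_mono hMt h.partFun_le)
  obtain ⟨S₀, ψ₀, h₀, hmax⟩ := exists_maximal_potential hα hμ
  have hρ : gibbs α S₀ ψ₀ ∈ P1 d := h₀.gibbs_mem_P1 hα hμ (hmax ▸ hM0)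
  have hFρ : Ffun α μ (gibbs α S₀ ψ₀) ≤ ((-Real.log M : ℝ) : EReal) := by
    have := h₀.Ffun_gibbs_le hα hμ (hmax ▸ hM0)
    rwa [hmax] at this
  refine ⟨⟨gibbs α S₀ ψ₀, hρ, fun σ hσ => ?_⟩, fun ρ hmin => ?_⟩
  · by_cases hF : Ffun α μ σ = ⊤
    · rw [hF]; exact le_top
    · obtain ⟨S, ψ, hadm, h0, -, c, hc, hFc, -⟩ := key σ hσ hF
      rw [hFc]
      refine hFρ.trans ?_
      have := hlog hadm h0
      exact_mod_cast (by linarith : -Real.log M ≤ c - Real.log (partFun α S ψ).toReal)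
  · have hF := (hmin.2 _ hρ).trans hFρ
    obtain ⟨S, ψ, hadm, h0, hT, c, hc, hFc, heq⟩ :=
      key ρ hmin.1 (ne_top_of_le_ne_top (EReal.coe_ne_top _) hF)
    rw [hFc] at hF
    have hF' : c - Real.log (partFun α S ψ).toReal ≤ -Real.log M := by exact_mod_cast hF
    have h1 := hlog hadm h0
    have hpt := hadm.partFun_ne_top hα hμ
    have h2 : (partFun α S ψ).toReal = M :=
      Real.log_injOn_pos (ENNReal.toReal_pos h0 hpt) (ENNReal.toReal_pos hM0 hMt) (by linarith)
    exact ⟨S, ψ, hadm, (ENNReal.toReal_eq_toReal_iff' hpt hMt).1 h2, heq (by linarith), hT⟩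

end GibbsMeasure

section Uniqueness

/-- Jensen's inequality for the exponential of a bounded function. -/
theorem ofReal_exp_integral_le {X : Type*} [MeasurableSpace X] {ν : Measure X}
    [IsProbabilityMeasure ν] {a : X → ℝ} (ha : Measurable a) {C : ℝ} (hC : ∀ x, |a x| ≤ C) :
    ENNReal.ofReal (Real.exp (∫ x, a x ∂ν)) ≤ ∫⁻ x, ENNReal.ofReal (Real.exp (a x)) ∂ν := by
  have hai : Integrable a ν := .of_bound ha.aestronglyMeasurable C (.of_forall hC)
  have hei : Integrable (fun x => Real.exp (a x)) ν := by
    refine .of_bound (C := Real.exp C) (by fun_prop) (.of_forall fun x => ?_)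
    rw [Real.norm_of_nonneg (Real.exp_pos _).le]
    exact Real.exp_le_exp.2 ((le_abs_self _).trans (hC x))
  rw [← ofReal_integral_eq_lintegral_ofReal hei (.of_forall fun x => (Real.exp_pos _).le)]
  exact ENNReal.ofReal_le_ofReal (convexOn_exp.map_integral_le Real.continuous_exp.continuousOn
    isClosed_univ (.of_forall fun _ => mem_univ _) hai hei)

variable {d : ℕ} {α : ℝ} {μ : Measure (Ed d)} {S₀ S₁ : Set (Ed d)} {ψ₀ ψ₁ : Ed d → ℝ}

theorem lintegral_gibbs {S : Set (Ed d)} {ψ : Ed d → ℝ} {f : Ed d → ℝ≥0∞} (hf : Measurable f) :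
    ∫⁻ x, f x ∂(gibbs α S ψ) =
      ENNReal.ofReal (1 / (partFun α S ψ).toReal) * ∫⁻ x, gdens α (supAff S ψ) x * f x := by
  have hg := measurable_gdens (α := α) (measurable_supAff S ψ)
  rw [gibbs, lintegral_withDensity_eq_lintegral_mul _ (hg.const_mul _) hf,
    ← lintegral_const_mul (μ := volume) (f := fun x => gdens α (supAff S ψ) x * f x) _ (hg.mul hf)]
  simp only [Pi.mul_apply, mul_assoc]

/-- The transport-type inequality between two Gibbs measures of maximal potentials. -/
theorem lintegral_gibbs_mul_le (hα : 0 < α) (hμ : μ ∈ P1 d) (h₀ : Admissible μ S₀ ψ₀)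
    (h₁ : Admissible μ S₁ ψ₁) (hm₀ : partFun α S₀ ψ₀ = maxPart α μ)
    (hm₁ : partFun α S₁ ψ₁ = maxPart α μ) {a b : Ed d → ℝ} (ha : Measurable a)
    (hb : Measurable b) (hab : ∀ x y, a x + b y ≤ α / 8 * ‖x - y‖ ^ 2) :
    (∫⁻ x, ENNReal.ofReal (Real.exp (2 * a x)) ∂(gibbs α S₀ ψ₀)) *
      (∫⁻ x, ENNReal.ofReal (Real.exp (2 * b x)) ∂(gibbs α S₁ ψ₁)) ≤ 1 := by
  have := hμ.1
  have hmid := h₀.midpoint h₁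
  have h := (lintegral_gdens_mul_le hmid.nonempty (ψ₀ := ψ₀) (ψ₁ := ψ₁) ha hb hab).trans
    (pow_le_pow_left₀ zero_le (hmid.partFun_le (α := α)) 2)
  have hM0 := maxPart_ne_zero hα hμ
  have hMt := maxPart_ne_top hα hμ
  rw [lintegral_gibbs (by fun_prop), lintegral_gibbs (by fun_prop), hm₀, hm₁]
  set M := maxPart α μ
  have hinv : ENNReal.ofReal (1 / M.toReal) = M⁻¹ := by
    rw [one_div, ENNReal.ofReal_inv_of_pos (ENNReal.toReal_pos hM0 hMt), ENNReal.ofReal_toReal hMt]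
  rw [hinv, mul_mul_mul_comm]
  calc _ ≤ M⁻¹ * M⁻¹ * M ^ 2 := by gcongr
    _ = (M⁻¹ * M) * (M⁻¹ * M) := by ring
    _ = 1 := by rw [ENNReal.inv_mul_cancel hM0 hMt, one_mul]

theorem integral_gibbs_le_of_lipschitz (hα : 0 < α) (hμ : μ ∈ P1 d) (h₀ : Admissible μ S₀ ψ₀)
    (h₁ : Admissible μ S₁ ψ₁) (hm₀ : partFun α S₀ ψ₀ = maxPart α μ)
    (hm₁ : partFun α S₁ ψ₁ = maxPart α μ) {η : Ed d → ℝ} {C : ℝ} {L : NNReal}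
    (hC : ∀ x, |η x| ≤ C) (hL : LipschitzWith L η) :
    ∫ x, η x ∂(gibbs α S₁ ψ₁) ≤ ∫ x, η x ∂(gibbs α S₀ ψ₀) := by
  have hM0 := maxPart_ne_zero hα hμ
  have hMt := maxPart_ne_top hα hμ
  have hp₀ := isProbabilityMeasure_gibbs (hm₀ ▸ hM0) (hm₀ ▸ hMt)
  have hp₁ := isProbabilityMeasure_gibbs (hm₁ ▸ hM0) (hm₁ ▸ hMt)
  have hη : Measurable η := hL.continuous.measurable
  have hi : ∀ (ν : Measure (Ed d)) [IsProbabilityMeasure ν], Integrable η ν := fun ν _ =>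
    .of_bound hη.aestronglyMeasurable C (.of_forall hC)
  set c : ℝ := 2 * (L : ℝ) ^ 2 / α with hc
  have hc0 : 0 ≤ c := by positivity
  refine le_of_forall_pos_le_add fun δ hδ => ?_
  obtain ⟨ε, hε, hεδ⟩ : ∃ ε : ℝ, 0 < ε ∧ c * ε ≤ δ :=
    ⟨δ / (c + 1), by positivity, by
      rw [mul_div_assoc', div_le_iff₀ (by positivity)]; nlinarith⟩
  set a : Ed d → ℝ := fun x => -(ε * η x) - c * ε ^ 2 with ha
  set b : Ed d → ℝ := fun x => ε * η x with hb
  have hab : ∀ x y, a x + b y ≤ α / 8 * ‖x - y‖ ^ 2 := by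
    intro x y
    have h1 : η y - η x ≤ L * ‖x - y‖ := by
      have := hL.dist_le_mul y x
      rw [Real.dist_eq, dist_eq_norm, norm_sub_rev] at this
      exact (le_abs_self _).trans this
    have h2 : ε * (L * ‖x - y‖) ≤ α / 8 * ‖x - y‖ ^ 2 + c * ε ^ 2 := by
      have h3 : α / 8 * ‖x - y‖ ^ 2 + c * ε ^ 2 - ε * (L * ‖x - y‖) =
          (α * ‖x - y‖ - 4 * ε * L) ^ 2 / (8 * α) := by
        rw [hc]; field_simp; ring
      have h4 : 0 ≤ (α * ‖x - y‖ - 4 * ε * L) ^ 2 / (8 * α) := by positivity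
      linarith
    have h5 := mul_le_mul_of_nonneg_left h1 hε.le
    simp only [ha, hb]
    linarith
  have hma : Measurable a := by fun_prop
  have hmb : Measurable b := by fun_prop
  have h := lintegral_gibbs_mul_le hα hμ h₀ h₁ hm₀ hm₁ hma hmb hab
  have hηε : ∀ x, |ε * η x| ≤ ε * C := fun x => by
    rw [abs_mul, abs_of_pos hε]
    exact mul_le_mul_of_nonneg_left (hC x) hε.le
  have hA := ofReal_exp_integral_le (ν := gibbs α S₀ ψ₀) (a := fun x => 2 * a x) (by fun_prop)
    (C := 2 * (ε * C + c * ε ^ 2)) fun x => by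
      have h1 := abs_le.1 (hηε x)
      have h2 : 0 ≤ c * ε ^ 2 := by positivity
      rw [abs_le]
      simp only [ha]
      constructor <;> linarith
  have hB := ofReal_exp_integral_le (ν := gibbs α S₁ ψ₁) (a := fun x => 2 * b x) (by fun_prop)
    (C := 2 * (ε * C)) fun x => by
      have h1 := abs_le.1 (hηε x)
      rw [abs_le]
      simp only [hb]
      constructor <;> linarith
  have hIa : ∫ x, a x ∂(gibbs α S₀ ψ₀) = -(ε * ∫ x, η x ∂(gibbs α S₀ ψ₀)) - c * ε ^ 2 := by
    have hn : Integrable (fun x => -(ε * η x)) (gibbs α S₀ ψ₀) := ((hi _).const_mul ε).neg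
    rw [ha, integral_sub hn (integrable_const _), integral_neg, integral_const_mul]
    simp
  have hAB := (mul_le_mul' hA hB).trans h
  rw [← ENNReal.ofReal_mul (Real.exp_pos _).le, ← Real.exp_add, ← ENNReal.ofReal_one,
    ENNReal.ofReal_le_ofReal_iff zero_le_one, Real.exp_le_one_iff, integral_const_mul,
    integral_const_mul, hIa, hb, integral_const_mul] at hAB
  refine le_of_mul_le_mul_left ?_ hε
  nlinarith

theorem gibbs_eq_of_maximal (hα : 0 < α) (hμ : μ ∈ P1 d) (h₀ : Admissible μ S₀ ψ₀)
    (h₁ : Admissible μ S₁ ψ₁) (hm₀ : partFun α S₀ ψ₀ = maxPart α μ)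
    (hm₁ : partFun α S₁ ψ₁ = maxPart α μ) : gibbs α S₀ ψ₀ = gibbs α S₁ ψ₁ := by
  have hM0 := maxPart_ne_zero hα hμ
  have hMt := maxPart_ne_top hα hμ
  have hp₀ := isProbabilityMeasure_gibbs (hm₀ ▸ hM0) (hm₀ ▸ hMt)
  have hp₁ := isProbabilityMeasure_gibbs (hm₁ ▸ hM0) (hm₁ ▸ hMt)
  let ν₀ : ProbabilityMeasure (Ed d) := ⟨gibbs α S₀ ψ₀, hp₀⟩
  let ν₁ : ProbabilityMeasure (Ed d) := ⟨gibbs α S₁ ψ₁, hp₁⟩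
  have h : Tendsto (fun _ : ℕ => ν₀) atTop (𝓝 ν₁) := by
    rw [tendsto_iff_forall_lipschitz_integral_tendsto]
    rintro η ⟨C, hC⟩ ⟨L, hL⟩
    have hbd : ∀ x, |η x| ≤ C + |η 0| := fun x => by
      have h1 := hC x 0
      rw [Real.dist_eq] at h1
      have h2 := abs_sub_abs_le_abs_sub (η x) (η 0)
      linarith
    have e : ∫ x, η x ∂(gibbs α S₀ ψ₀) = ∫ x, η x ∂(gibbs α S₁ ψ₁) :=
      le_antisymm (integral_gibbs_le_of_lipschitz hα hμ h₁ h₀ hm₁ hm₀ hbd hL)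
        (integral_gibbs_le_of_lipschitz hα hμ h₀ h₁ hm₀ hm₁ hbd hL)
    exact e ▸ tendsto_const_nhds
  have hν : ν₀ = ν₁ := tendsto_nhds_unique tendsto_const_nhds h
  exact congrArg Subtype.val hν

end Uniqueness

end Minimizer

/-- existence, uniqueness and characterization of the minimizer of `F_μ`. -/
theorem stmt0 (d : ℕ) (hd : 1 ≤ d) (α : ℝ) (hα : 0 < α)
    (μ : Measure (Ed d)) (hμ : μ ∈ P1 d) :
    (∃! ρ : Measure (Ed d), IsMinOfF α μ ρ) ∧
      ∀ ρ : Measure (Ed d), IsMinOfF α μ ρ →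
        ∃ (u : Ed d → EReal) (Z : ℝ), 0 < Z ∧ EConvexOn u ∧ LowerSemicontinuous u ∧
          ρ = (volume : Measure (Ed d)).withDensity
            (fun x => ENNReal.ofReal (1 / Z) * gdens α u x) ∧
          maxCorr ρ μ = eInt ρ u + eInt μ (legendre u) := by
  obtain ⟨⟨ρ, hρ⟩, hchar⟩ := exists_isMinOfF hα hμ
  refine ⟨⟨ρ, hρ, fun σ hσ => ?_⟩, fun σ hσ => ?_⟩
  · obtain ⟨S₀, ψ₀, h₀, hm₀, e₀, -⟩ := hchar ρ hρ
    obtain ⟨S₁, ψ₁, h₁, hm₁, e₁, -⟩ := hchar σ hσ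
    rw [e₀, e₁]
    exact gibbs_eq_of_maximal hα hμ h₁ h₀ hm₁ hm₀
  · obtain ⟨S, ψ, h, hm, e, hT⟩ := hchar σ hσ
    refine ⟨supAff S ψ, (partFun α S ψ).toReal, ?_, econvexOn_supAff S ψ,
      lowerSemicontinuous_supAff S ψ, e, hT⟩
    rw [hm]
    exact ENNReal.toReal_pos (maxPart_ne_zero hα hμ) (maxPart_ne_top hα hμ)
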